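/- arXiv:1103.3995 — 2 statements merged into one kernel-verified Lean document; each statement's English description precedes it below -/
import Mathlib

section
/- Let a, b, c and (l_ij), (m_ij) and F be as in the generalized Monge–Ampère setup. Any twice continuously differentiable biperiodic function p : ℝ² → ℝ satisfying the generalized Monge–Ampère equation (GMA) and the ellipticity condition (E) is smooth (of class C^∞). -/
open MeasureTheory

/-- Partial derivative in the first variable. -/
noncomputable def pdx (p : ℝ × ℝ → ℝ) (z : ℝ × ℝ) : ℝ := fderiv ℝ p z (1, 0)

/-- Partial derivative in the second variable. -/
noncomputable def pdy (p : ℝ × ℝ → ℝ) (z : ℝ × ℝ) : ℝ := fderiv ℝ p z (0, 1)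

/-- A function `ℝ² → ℝ` is biperiodic if it has period 1 in each variable. -/
def Biperiodic (p : ℝ × ℝ → ℝ) : Prop :=
  ∀ x y : ℝ, p (x + 1, y) = p (x, y) ∧ p (x, y + 1) = p (x, y)

/-- The integral over the torus `𝕋² = ℝ²/ℤ²` of (the descent of) a biperiodic function. -/
noncomputable def torusInt (f : ℝ × ℝ → ℝ) : ℝ := ∫ x in (0:ℝ)..1, ∫ y in (0:ℝ)..1, f (x, y)


/-! ### The torus integral -/

/-- Representative in `ℝ × ℝ` of a point of the torus. -/
noncomputable def rep (t : UnitAddTorus (Fin 2)) : ℝ × ℝ :=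
  ((AddCircle.equivIco 1 0 (t 0) : ℝ), (AddCircle.equivIco 1 0 (t 1) : ℝ))

/-- Projection to the torus. -/
noncomputable def proj (z : ℝ × ℝ) : UnitAddTorus (Fin 2) := ![(z.1 : UnitAddCircle), (z.2 : UnitAddCircle)]

/-- Haar measure on the torus. -/
noncomputable def muT : Measure (UnitAddTorus (Fin 2)) :=
  Measure.pi fun _ => (AddCircle.haarAddCircle : Measure UnitAddCircle)

instance muT_prob : IsProbabilityMeasure muT := by
  unfold muT; infer_instance

instance muT_haar : muT.IsAddHaarMeasure := by
  unfold muT; infer_instance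

/-- Integral over the torus. -/
noncomputable def II (f : ℝ × ℝ → ℝ) : ℝ := ∫ t, f (rep t) ∂muT

lemma proj_rep (t : UnitAddTorus (Fin 2)) : proj (rep t) = t := by
  funext i
  fin_cases i
  · exact AddCircle.coe_equivIco 
  · exact AddCircle.coe_equivIco

lemma proj_add (z w : ℝ × ℝ) : proj (z + w) = proj z + proj w := by
  funext i
  fin_cases i <;> simp [proj]

lemma bip_congr {E : Type*} {f : ℝ × ℝ → E}
    (hf : ∀ x y : ℝ, f (x + 1, y) = f (x, y) ∧ f (x, y + 1) = f (x, y))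
    {z w : ℝ × ℝ} (h : proj z = proj w) : f z = f w := by
  obtain ⟨x, y⟩ := z
  obtain ⟨x', y'⟩ := w
  have h0 : (x : UnitAddCircle) = x' := congrFun h 0
  have h1 : (y : UnitAddCircle) = y' := congrFun h 1
  rw [← sub_eq_zero, ← AddCircle.coe_sub, AddCircle.coe_eq_zero_iff] at h0 h1
  obtain ⟨n, hn⟩ := h0
  obtain ⟨m, hm⟩ := h1
  have e1 : x = x' + n * 1 := by simp at hn; linarith
  have e2 : y = y' + m * 1 := by simp at hm; linarith
  have p1 : Function.Periodic (fun x => f (x, y)) 1 := fun x => (hf x y).1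
  have p2 : Function.Periodic (fun y => f (x', y)) 1 := fun y => (hf x' y).2
  have q1 := p1.int_mul n x'
  have q2 := p2.int_mul m y'
  rw [e1]
  refine Eq.trans q1 ?_
  rw [e2]
  exact q2

lemma continuous_proj : Continuous proj := by
  unfold proj
  refine continuous_pi fun i => ?_
  fin_cases i
  · exact (AddCircle.continuous_mk' 1).comp continuous_fst
  · exact (AddCircle.continuous_mk' 1).comp continuous_snd

lemma proj_quot : IsOpenQuotientMap proj := by
  have h1 : IsOpenQuotientMap (fun x : ℝ => (x : UnitAddCircle)) :=
    QuotientAddGroup.isOpenQuotientMap_mk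
  have h2 := h1.prodMap h1
  have h3 := (Homeomorph.finTwoArrow (X := UnitAddCircle)).symm.isOpenQuotientMap.comp h2
  exact h3

/-- Continuous biperiodic functions. -/
structure BC (f : ℝ × ℝ → ℝ) : Prop where
  cont : Continuous f
  per : Biperiodic f

lemma rep_cont' {E : Type*} [TopologicalSpace E] {f : ℝ × ℝ → E} (hc : Continuous f)
    (hf : ∀ x y : ℝ, f (x + 1, y) = f (x, y) ∧ f (x, y + 1) = f (x, y)) :
    Continuous fun t => f (rep t) := by
  have : (fun t => f (rep t)) ∘ proj = f := by
    funext z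
    exact bip_congr hf (proj_rep _)
  rw [proj_quot.isQuotientMap.continuous_iff, this]
  exact hc

lemma BC.rep_cont {f : ℝ × ℝ → ℝ} (hf : BC f) : Continuous fun t => f (rep t) :=
  rep_cont' hf.cont hf.per

lemma BC.integrable {f : ℝ × ℝ → ℝ} (hf : BC f) : Integrable (fun t => f (rep t)) muT :=
  hf.rep_cont.integrable_of_hasCompactSupport (HasCompactSupport.of_compactSpace _)

lemma BC.rep_proj {f : ℝ × ℝ → ℝ} (hf : BC f) (z : ℝ × ℝ) : f (rep (proj z)) = f z :=
  bip_congr hf.per (proj_rep _)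

lemma BC.bdd {f : ℝ × ℝ → ℝ} (hf : BC f) : ∃ C, 0 < C ∧ ∀ z, |f z| ≤ C := by
  obtain ⟨C, hC⟩ := (isCompact_range hf.rep_cont).isBounded.exists_norm_le
  refine ⟨max C 1, by positivity, fun z => ?_⟩
  have := hC (f (rep (proj z))) ⟨_, rfl⟩
  rw [hf.rep_proj] at this
  exact this.trans (le_max_left _ _)

lemma BC.const (c : ℝ) : BC fun _ => c := ⟨continuous_const, fun _ _ => ⟨rfl, rfl⟩⟩

lemma BC.add {f g : ℝ × ℝ → ℝ} (hf : BC f) (hg : BC g) : BC fun z => f z + g z :=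
  ⟨hf.cont.add hg.cont, fun x y => by
    simp only [(hf.per x y).1, (hf.per x y).2, (hg.per x y).1, (hg.per x y).2, and_self]⟩

lemma BC.sub {f g : ℝ × ℝ → ℝ} (hf : BC f) (hg : BC g) : BC fun z => f z - g z :=
  ⟨hf.cont.sub hg.cont, fun x y => by
    simp only [(hf.per x y).1, (hf.per x y).2, (hg.per x y).1, (hg.per x y).2, and_self]⟩

lemma BC.mul {f g : ℝ × ℝ → ℝ} (hf : BC f) (hg : BC g) : BC fun z => f z * g z :=
  ⟨hf.cont.mul hg.cont, fun x y => by
    simp only [(hf.per x y).1, (hf.per x y).2, (hg.per x y).1, (hg.per x y).2, and_self]⟩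

lemma BC.comp {f : ℝ × ℝ → ℝ} (hf : BC f) {φ : ℝ → ℝ} (hφ : Continuous φ) : BC fun z => φ (f z) :=
  ⟨hφ.comp hf.cont, fun x y => by
    simp only [(hf.per x y).1, (hf.per x y).2, and_self]⟩

lemma BC.neg {f : ℝ × ℝ → ℝ} (hf : BC f) : BC fun z => - f z := hf.comp continuous_neg
lemma BC.abs {f : ℝ × ℝ → ℝ} (hf : BC f) : BC fun z => |f z| := hf.comp continuous_abs
lemma BC.cmul {f : ℝ × ℝ → ℝ} (hf : BC f) (c : ℝ) : BC fun z => c * f z :=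
  hf.comp (continuous_const_mul c)
lemma BC.sq {f : ℝ × ℝ → ℝ} (hf : BC f) : BC fun z => f z ^ 2 := hf.comp (continuous_pow 2)
lemma BC.rpow {f : ℝ × ℝ → ℝ} (hf : BC f) {r : ℝ} (hr : 0 ≤ r) : BC fun z => |f z| ^ r :=
  hf.abs.comp (Real.continuous_rpow_const hr)

lemma BC.shift {f : ℝ × ℝ → ℝ} (hf : BC f) (v : ℝ × ℝ) : BC fun z => f (z + v) := by
  refine ⟨hf.cont.comp (continuous_add_const v), fun x y => ⟨?_, ?_⟩⟩
  · have : ((x + 1, y) + v : ℝ × ℝ) = ((x + v.1) + 1, y + v.2) := by ext <;> simp; ring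
    rw [this, (hf.per _ _).1]; rfl
  · have : ((x, y + 1) + v : ℝ × ℝ) = ((x + v.1), (y + v.2) + 1) := by ext <;> simp; ring
    rw [this, (hf.per _ _).2]; rfl

lemma BC.sum {ι : Type*} (s : Finset ι) {f : ι → ℝ × ℝ → ℝ} (hf : ∀ i ∈ s, BC (f i)) :
    BC fun z => ∑ i ∈ s, f i z := by
  classical
  induction s using Finset.induction_on with
  | empty => simpa using BC.const 0
  | insert a s ha ih =>
    simp only [Finset.sum_insert ha]
    exact (hf a (by simp)).add (ih fun i hi => hf i (by simp [hi]))

lemma II_const (c : ℝ) : II (fun _ => c) = c := by simp [II]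

lemma II_add {f g : ℝ × ℝ → ℝ} (hf : BC f) (hg : BC g) : II (fun z => f z + g z) = II f + II g :=
  integral_add hf.integrable hg.integrable

lemma II_sub {f g : ℝ × ℝ → ℝ} (hf : BC f) (hg : BC g) : II (fun z => f z - g z) = II f - II g :=
  integral_sub hf.integrable hg.integrable

lemma II_cmul (f : ℝ × ℝ → ℝ) (c : ℝ) : II (fun z => c * f z) = c * II f :=
  integral_const_mul _ _

lemma II_neg (f : ℝ × ℝ → ℝ) : II (fun z => - f z) = - II f :=
  integral_neg _

lemma II_mono {f g : ℝ × ℝ → ℝ} (hf : BC f) (hg : BC g) (h : ∀ z, f z ≤ g z) : II f ≤ II g :=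
  integral_mono hf.integrable hg.integrable fun t => h (rep t)

lemma II_nonneg {f : ℝ × ℝ → ℝ} (h : ∀ z, 0 ≤ f z) : 0 ≤ II f :=
  integral_nonneg fun t => h (rep t)

lemma II_sum {ι : Type*} (s : Finset ι) {f : ι → ℝ × ℝ → ℝ} (hf : ∀ i ∈ s, BC (f i)) :
    II (fun z => ∑ i ∈ s, f i z) = ∑ i ∈ s, II (f i) :=
  integral_finsetSum s fun i hi => (hf i hi).integrable

lemma II_shift {f : ℝ × ℝ → ℝ} (hf : BC f) (v : ℝ × ℝ) : II (fun z => f (z + v)) = II f := by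
  have h : ∀ t, f (rep t + v) = f (rep (t + proj v)) := fun t =>
    bip_congr hf.per (by rw [proj_add, proj_rep, proj_rep])
  unfold II
  simp only [h]
  exact integral_add_right_eq_self (fun t => f (rep t)) (proj v)

/-! ### Differences -/

lemma fwd_apply (v : ℝ × ℝ) (f : ℝ × ℝ → ℝ) (z : ℝ × ℝ) : fwdDiff v f z = f (z + v) - f z := rfl

lemma BC.fwd {f : ℝ × ℝ → ℝ} (hf : BC f) (v : ℝ × ℝ) : BC (fwdDiff v f) := (hf.shift v).sub hf

/-- Iterated difference. -/
def dk (v : ℝ × ℝ) (k : ℕ) (f : ℝ × ℝ → ℝ) : ℝ × ℝ → ℝ := (fwdDiff v)^[k] f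

lemma dk_zero (v : ℝ × ℝ) (f : ℝ × ℝ → ℝ) : dk v 0 f = f := rfl
lemma dk_succ (v : ℝ × ℝ) (k : ℕ) (f : ℝ × ℝ → ℝ) : dk v (k+1) f = fwdDiff v (dk v k f) :=
  Function.iterate_succ_apply' _ _ _
lemma dk_succ' (v : ℝ × ℝ) (k : ℕ) (f : ℝ × ℝ → ℝ) : dk v (k+1) f = dk v k (fwdDiff v f) := rfl
lemma dk_succ_apply (v : ℝ × ℝ) (k : ℕ) (f : ℝ × ℝ → ℝ) (z : ℝ × ℝ) :
    dk v (k+1) f z = dk v k f (z + v) - dk v k f z := by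
  rw [dk_succ]; rfl

lemma BC.dk {f : ℝ × ℝ → ℝ} (hf : BC f) (v : ℝ × ℝ) (k : ℕ) : BC (dk v k f) := by
  induction k with
  | zero => exact hf
  | succ k ih => rw [dk_succ]; exact ih.fwd v

lemma dk_add (v : ℝ × ℝ) (k : ℕ) (f g : ℝ × ℝ → ℝ) (z : ℝ × ℝ) :
    dk v k (fun z => f z + g z) z = dk v k f z + dk v k g z := by
  induction k generalizing z with
  | zero => rfl
  | succ k ih => simp only [dk_succ_apply, ih]; ring

lemma dk_sub (v : ℝ × ℝ) (k : ℕ) (f g : ℝ × ℝ → ℝ) (z : ℝ × ℝ) :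
    dk v k (fun z => f z - g z) z = dk v k f z - dk v k g z := by
  induction k generalizing z with
  | zero => rfl
  | succ k ih => simp only [dk_succ_apply, ih]; ring

lemma dk_cmul (v : ℝ × ℝ) (k : ℕ) (c : ℝ) (f : ℝ × ℝ → ℝ) (z : ℝ × ℝ) :
    dk v k (fun z => c * f z) z = c * dk v k f z := by
  induction k generalizing z with
  | zero => rfl
  | succ k ih => simp only [dk_succ_apply, ih]; ring

lemma dk_const (v : ℝ × ℝ) (k : ℕ) (c : ℝ) (z : ℝ × ℝ) :
    dk v (k+1) (fun _ => c) z = 0 := by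
  induction k generalizing z with
  | zero => simp [dk_succ_apply, dk_zero]
  | succ k ih => rw [dk_succ_apply, ih, ih]; ring

/-- Leibniz rule for iterated differences. -/
lemma dk_mul (v : ℝ × ℝ) (k : ℕ) (f g : ℝ × ℝ → ℝ) (z : ℝ × ℝ) :
    dk v k (fun z => f z * g z) z =
      ∑ ij ∈ Finset.HasAntidiagonal.antidiagonal k, (k.choose ij.1 : ℝ) *
        (dk v ij.1 f z * dk v ij.2 g (z + ij.1 • v)) := by
  induction k generalizing z with
  | zero => simp [dk_zero]
  | succ k ih =>
    rw [Finset.sum_antidiagonal_choose_succ_mul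
      (fun i j => dk v i f z * dk v j g (z + i • v)) k, dk_succ_apply, ih, ih,
      ← Finset.sum_sub_distrib, ← Finset.sum_add_distrib]
    refine Finset.sum_congr rfl ?_
    rintro ⟨i, j⟩ hij
    rw [Finset.HasAntidiagonal.mem_antidiagonal] at hij
    have hs : k.choose j = k.choose i := Nat.choose_symm_of_eq_add (by omega)
    simp only [dk_succ_apply, hs]
    have e1 : z + v + i • v = z + (i+1) • v := by rw [succ_nsmul]; abel
    have e2 : z + i • v + v = z + (i+1) • v := by rw [succ_nsmul]; abel
    rw [e1, e2]
    ring

/-- Summation by parts. -/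
lemma II_fwd_mul {f g : ℝ × ℝ → ℝ} (hf : BC f) (hg : BC g) (v : ℝ × ℝ) :
    II (fun z => fwdDiff v f z * g z) = - II (fun z => f (z + v) * fwdDiff v g z) := by
  have h1 : II (fun z => f (z + v) * g (z + v)) = II (fun z => f z * g z) :=
    II_shift (hf.mul hg) v
  have h2 : (fun z => fwdDiff v f z * g z) = fun z => f (z+v) * g z - f z * g z := by
    funext z; rw [fwd_apply]; ring
  have h3 : (fun z => f (z + v) * fwdDiff v g z) =
      fun z => f (z+v) * g (z+v) - f (z+v) * g z := by
    funext z; rw [fwd_apply]; ring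
  rw [h2, h3, II_sub ((hf.shift v).mul hg) (hf.mul hg),
    II_sub ((hf.shift v).mul (hg.shift v)) ((hf.shift v).mul hg), h1]
  ring

/-! ### Elementary inequalities -/

lemma young3 {a b c s t u : ℝ} (ha : 0 ≤ a) (hb : 0 ≤ b) (hc : 0 ≤ c)
    (hs : 0 < s) (ht : 0 < t) (hu : 0 < u) (h : s⁻¹ + t⁻¹ + u⁻¹ = 1) :
    a * b * c ≤ a ^ s + b ^ t + c ^ u := by
  have h1 := Real.geom_mean_le_arith_mean3_weighted (inv_pos.2 hs).le (inv_pos.2 ht).le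
    (inv_pos.2 hu).le (Real.rpow_nonneg ha s) (Real.rpow_nonneg hb t) (Real.rpow_nonneg hc u) h
  rw [Real.rpow_rpow_inv ha hs.ne', Real.rpow_rpow_inv hb ht.ne',
    Real.rpow_rpow_inv hc hu.ne'] at h1
  have p1 := inv_pos.2 hs
  have p2 := inv_pos.2 ht
  have p3 := inv_pos.2 hu
  have q1 := Real.rpow_nonneg ha s
  have q2 := Real.rpow_nonneg hb t
  have q3 := Real.rpow_nonneg hc u
  have r1 : s⁻¹ * a ^ s ≤ 1 * a ^ s := mul_le_mul_of_nonneg_right (by linarith) q1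
  have r2 : t⁻¹ * b ^ t ≤ 1 * b ^ t := mul_le_mul_of_nonneg_right (by linarith) q2
  have r3 : u⁻¹ * c ^ u ≤ 1 * c ^ u := mul_le_mul_of_nonneg_right (by linarith) q3
  linarith

lemma young2 {a b s t : ℝ} (ha : 0 ≤ a) (hb : 0 ≤ b)
    (hs : 0 < s) (ht : 0 < t) (h : s⁻¹ + t⁻¹ = 1) :
    a * b ≤ a ^ s + b ^ t := by
  have h1 := Real.geom_mean_le_arith_mean2_weighted (inv_pos.2 hs).le (inv_pos.2 ht).le
    (Real.rpow_nonneg ha s) (Real.rpow_nonneg hb t) h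
  rw [Real.rpow_rpow_inv ha hs.ne', Real.rpow_rpow_inv hb ht.ne'] at h1
  have p1 := inv_pos.2 hs
  have p2 := inv_pos.2 ht
  have q1 := Real.rpow_nonneg ha s
  have q2 := Real.rpow_nonneg hb t
  have r1 : s⁻¹ * a ^ s ≤ 1 * a ^ s := mul_le_mul_of_nonneg_right (by linarith) q1
  have r2 : t⁻¹ * b ^ t ≤ 1 * b ^ t := mul_le_mul_of_nonneg_right (by linarith) q2
  linarith

/-- The function `|t|^r t`. -/
noncomputable def phi (r t : ℝ) : ℝ := |t| ^ r * t

lemma phi_cont {r : ℝ} (hr : 0 ≤ r) : Continuous (phi r) :=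
  ((Real.continuous_rpow_const hr).comp continuous_abs).mul continuous_id

lemma bern {r s t : ℝ} (hr : 0 ≤ r) (ht : 0 ≤ t) (hts : t ≤ s) :
    (s ^ r - t ^ r) * s ≤ (r + 1) * s ^ r * (s - t) := by
  rcases eq_or_lt_of_le (ht.trans hts) with h0 | hs
  · rw [← h0] at hts ⊢
    have : t = 0 := le_antisymm hts ht
    simp [this]
  have hsr : 0 < s ^ r := Real.rpow_pos_of_pos hs r
  have key : 1 - (t / s) ^ r ≤ (r + 1) * (1 - t / s) := by
    have hx0 : 0 ≤ t / s := by positivity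
    have hx1 : t / s ≤ 1 := (div_le_one hs).2 hts
    rcases le_total 1 r with h1 | h1
    · have := one_add_mul_self_le_rpow_one_add (s := t / s - 1) (by linarith) h1
      rw [add_sub_cancel] at this
      nlinarith
    · have := Real.rpow_le_rpow_of_exponent_ge' hx0 hx1 hr h1
      rw [Real.rpow_one] at this
      nlinarith
  rw [Real.div_rpow ht hs.le] at key
  have e1 : (s ^ r - t ^ r) * s = (1 - t ^ r / s ^ r) * (s ^ r * s) := by field_simp
  have e2 : (r + 1) * s ^ r * (s - t) = ((r + 1) * (1 - t / s)) * (s ^ r * s) := by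
    field_simp
  rw [e1, e2]
  exact mul_le_mul_of_nonneg_right key (by positivity)

lemma phi_lip_aux {r s t : ℝ} (hr : 0 ≤ r) (h : |t| ≤ |s|) :
    |phi r s - phi r t| ≤ (r + 2) * |s - t| * (|s| ^ r + |t| ^ r) := by
  have e : phi r s - phi r t = |t| ^ r * (s - t) + (|s| ^ r - |t| ^ r) * s := by
    unfold phi; ring
  have h1 := bern hr (abs_nonneg t) h
  have h2 : |t| ^ r ≤ |s| ^ r := Real.rpow_le_rpow (abs_nonneg t) h hr
  have h3 : |s| - |t| ≤ |s - t| := abs_sub_abs_le_abs_sub s t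
  have h4 : 0 ≤ |t| ^ r := Real.rpow_nonneg (abs_nonneg t) r
  have h5 : 0 ≤ |s| ^ r := Real.rpow_nonneg (abs_nonneg s) r
  have h6 : |(|s| ^ r - |t| ^ r) * s| = (|s| ^ r - |t| ^ r) * |s| := by
    rw [abs_mul, abs_of_nonneg (by linarith)]
  have h7 : |(|t| ^ r * (s - t))| = |t| ^ r * |s - t| := by
    rw [abs_mul, abs_of_nonneg h4]
  have h8 : (r + 1) * |s| ^ r * (|s| - |t|) ≤ (r + 1) * |s| ^ r * |s - t| :=
    mul_le_mul_of_nonneg_left h3 (by positivity)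
  have h9 := abs_nonneg (s - t)
  rw [e]
  refine (abs_add_le _ _).trans ?_
  rw [h6, h7]
  have : 0 ≤ (r + 1) * |s - t| * |t| ^ r := by positivity
  have : 0 ≤ |s - t| * |s| ^ r := by positivity
  nlinarith

lemma phi_lip {r : ℝ} (hr : 0 ≤ r) (s t : ℝ) :
    |phi r s - phi r t| ≤ (r + 2) * |s - t| * (|s| ^ r + |t| ^ r) := by
  rcases le_total |t| |s| with h | h
  · exact phi_lip_aux hr h
  · have := phi_lip_aux hr h
    rw [abs_sub_comm, abs_sub_comm s t, add_comm (|s| ^ r)]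
    exact this

/-! ### Discrete Gagliardo–Nirenberg inequality -/

/-- `∫ |Δ^j f|^(2k/j)`. -/
noncomputable def SS (k : ℕ) (v : ℝ × ℝ) (j : ℕ) (f : ℝ × ℝ → ℝ) : ℝ :=
  II fun z => |dk v j f z| ^ (2 * k / j : ℝ)

lemma SS_nonneg (k : ℕ) (v : ℝ × ℝ) (j : ℕ) (f : ℝ × ℝ → ℝ) : 0 ≤ SS k v j f :=
  II_nonneg fun _ => Real.rpow_nonneg (abs_nonneg _) _

lemma expo_nonneg (k j : ℕ) : (0:ℝ) ≤ 2 * k / j := by positivity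

/-- First half of the estimate. -/
lemma gn_parts {k j : ℕ} (hj : 1 ≤ j) (hjk : j < k) {f : ℝ × ℝ → ℝ} (hf : BC f) (v : ℝ × ℝ) :
    SS k v j f ≤ (2 * k / j : ℝ) * II (fun z => |dk v (j-1) f (z + v)| * |dk v (j+1) f z| *
      (|dk v j f (z + v)| ^ (2 * k / j - 2 : ℝ) + |dk v j f z| ^ (2 * k / j - 2 : ℝ))) := by
  obtain ⟨i, rfl⟩ : ∃ i, j = i + 1 := ⟨j - 1, by omega⟩
  simp only [Nat.add_sub_cancel]
  set q : ℝ := (2 * k / (i + 1 : ℕ) : ℝ) with hq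
  have hq2 : 0 ≤ q - 2 := by
    rw [sub_nonneg, hq, le_div_iff₀ (by positivity)]
    have : ((i + 1 : ℕ) : ℝ) ≤ k := by exact_mod_cast hjk.le
    linarith
  have hi := hf.dk v i
  have hi1 := hf.dk v (i+1)
  have hi2 := hf.dk v (i+1+1)
  have hp : BC fun z => phi (q - 2) (dk v (i+1) f z) := hi1.comp (phi_cont hq2)
  have e1 : SS k v (i+1) f = II (fun z => fwdDiff v (dk v i f) z * phi (q - 2) (dk v (i+1) f z)) := by
    unfold SS
    congr 1
    funext z
    rw [← dk_succ, ← hq]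
    unfold phi
    have : q = (q - 2) + 2 := by ring
    rcases eq_or_ne (dk v (i+1) f z) 0 with h | h
    · rw [h]; simp; rw [Real.zero_rpow (by linarith)]
    · conv_lhs => rw [this, Real.rpow_add (abs_pos.2 h), Real.rpow_two, sq_abs]
      ring
  rw [e1, II_fwd_mul hi hp, ← II_neg, ← II_cmul]
  refine II_mono ((hi.shift v).mul (hp.fwd v)).neg ?_ ?_
  · exact (((hi.shift v).abs.mul hi2.abs).mul
      (((hi1.shift v).rpow hq2).add (hi1.rpow hq2))).cmul q
  intro z
  refine (neg_le_abs _).trans ?_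
  rw [abs_mul]
  have := phi_lip hq2 (dk v (i+1) f (z+v)) (dk v (i+1) f z)
  rw [← dk_succ_apply] at this
  rw [sub_add_cancel] at this
  have h2 := mul_le_mul_of_nonneg_left this (abs_nonneg (dk v i f (z + v)))
  refine h2.trans (le_of_eq ?_)
  ring

lemma SS_shift {k j : ℕ} {f : ℝ × ℝ → ℝ} (hf : BC f) (v w : ℝ × ℝ) :
    II (fun z => |dk v j f (z + w)| ^ (2 * k / j : ℝ)) = SS k v j f :=
  II_shift ((hf.dk v j).rpow (expo_nonneg k j)) w

lemma gn_base {k : ℕ} (hk : 1 < k) : ∀ η > 0, ∃ ε > 0, ∀ (v : ℝ × ℝ) (f : ℝ × ℝ → ℝ), BC f →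
    (∀ z, |f z| ≤ ε) → SS k v 1 f ≤ η * SS k v 2 f := by
  intro η hη
  have hk0 : (0:ℝ) < k := by positivity
  have hk1 : (1:ℝ) < k := by exact_mod_cast hk
  refine ⟨min (1 / (8 * k)) (η / (8 * k)), by positivity, fun v f hf hb => ?_⟩
  set ε : ℝ := min (1 / (8 * k)) (η / (8 * k)) with hε
  have hε0 : 0 < ε := by positivity
  have h1 := gn_parts (k := k) (j := 1) le_rfl hk hf v
  simp only [Nat.cast_one, div_one, Nat.sub_self, dk_zero] at h1
  have b1 := hf.dk v 1
  have b2 := hf.dk v 2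
  have hr : (0:ℝ) ≤ 2 * k - 2 := by linarith
  have hS1 : SS k v 1 f = II (fun z => |dk v 1 f z| ^ (2 * k : ℝ)) := by simp [SS]
  have hS1' : II (fun z => |dk v 1 f (z + v)| ^ (2 * k : ℝ)) = SS k v 1 f := by
    rw [← SS_shift (k := k) (j := 1) hf v v]; simp
  have hS2 : SS k v 2 f = II (fun z => |dk v 2 f z| ^ (k : ℝ)) := by
    unfold SS; congr 1; funext z; congr 1; push_cast; field_simp
  have bp : BC fun z => |dk v 2 f z| ^ (k : ℝ) := b2.rpow hk0.le
  have bq : BC fun z => |dk v 1 f z| ^ (2 * k : ℝ) := b1.rpow (by positivity)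
  have h2 : II (fun z => |f (z + v)| * |dk v (1+1) f z| *
      (|dk v 1 f (z + v)| ^ (2 * k - 2 : ℝ) + |dk v 1 f z| ^ (2 * k - 2 : ℝ))) ≤
      II (fun z => ε * ((2 * |dk v 2 f z| ^ (k : ℝ)) +
        (|dk v 1 f (z+v)| ^ (2 * k : ℝ) + |dk v 1 f z| ^ (2 * k : ℝ)))) := by
    refine II_mono (((hf.shift v).abs.mul b2.abs).mul
      (((b1.shift v).rpow hr).add (b1.rpow hr)))
      (((bp.cmul 2).add ((bq.shift v).add bq)).cmul ε) fun z => ?_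
    have y : ∀ c : ℝ, |dk v 2 f z| * |c| ^ (2 * k - 2 : ℝ) ≤
        |dk v 2 f z| ^ (k : ℝ) + |c| ^ (2 * k : ℝ) := by
      intro c
      have := young2 (a := |dk v 2 f z|) (b := |c| ^ (2 * k - 2 : ℝ)) (s := k) (t := k / (k - 1))
        (abs_nonneg _) (by positivity) hk0 (div_pos hk0 (by linarith))
        (by field_simp; ring)
      rw [← Real.rpow_mul (abs_nonneg c)] at this
      have e : (2 * k - 2 : ℝ) * (k / (k - 1)) = 2 * k := by
        have : (k - 1 : ℝ) ≠ 0 := by linarith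
        field_simp
      rwa [e] at this
    have y1 := y (dk v 1 f (z + v))
    have y2 := y (dk v 1 f z)
    have y3 := hb (z + v)
    rw [mul_assoc]
    refine mul_le_mul y3 ?_ (by positivity) hε0.le
    rw [mul_add]
    linarith
  rw [II_cmul, II_add (bp.cmul 2) ((bq.shift v).add bq), II_add (bq.shift v) bq, II_cmul,
    hS1', ← hS1, ← hS2] at h2
  have h3 := h1.trans (mul_le_mul_of_nonneg_left h2 (by positivity))
  have n1 := SS_nonneg k v 1 f
  have n2 := SS_nonneg k v 2 f
  have c1 : 2 * k * ε ≤ 1 / 4 := by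
    have : ε ≤ 1 / (8 * k) := min_le_left _ _
    calc 2 * k * ε ≤ 2 * k * (1 / (8 * k)) := by gcongr
      _ = 1 / 4 := by field_simp; norm_num
  have c2 : 2 * k * ε ≤ η / 4 := by
    have : ε ≤ η / (8 * k) := min_le_right _ _
    calc 2 * k * ε ≤ 2 * k * (η / (8 * k)) := by gcongr
      _ = η / 4 := by field_simp; norm_num
  have d1 := mul_le_mul_of_nonneg_right c1 n1
  have d2 := mul_le_mul_of_nonneg_right c2 n2
  nlinarith

lemma gn_step {k j : ℕ} (hj : 2 ≤ j) (hjk : j < k)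
    (ih : ∀ η > 0, ∃ ε > 0, ∀ (v : ℝ × ℝ) (f : ℝ × ℝ → ℝ), BC f →
      (∀ z, |f z| ≤ ε) → SS k v (j-1) f ≤ η * SS k v j f) :
    ∀ η > 0, ∃ ε > 0, ∀ (v : ℝ × ℝ) (f : ℝ × ℝ → ℝ), BC f →
      (∀ z, |f z| ≤ ε) → SS k v j f ≤ η * SS k v (j+1) f := by
  intro η hη
  obtain ⟨i, rfl⟩ : ∃ i, j = i + 2 := ⟨j - 2, by omega⟩
  have hi' : i + 2 - 1 = i + 1 := by omega
  simp only [hi'] at ih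
  have hk0 : (0:ℝ) < k := by have : 0 < k := by omega
                             positivity
  set q : ℝ := (2 * k / (i + 2 : ℕ) : ℝ) with hq
  set qm : ℝ := (2 * k / (i + 1 : ℕ) : ℝ) with hqm
  set qp : ℝ := (2 * k / (i + 2 + 1 : ℕ) : ℝ) with hqp
  have hik : ((i:ℝ) + 2) < k := by exact_mod_cast hjk
  have hik' : ((i:ℝ) + 3) ≤ k := by exact_mod_cast hjk
  have hq2 : 0 < q - 2 := by
    rw [sub_pos, hq, lt_div_iff₀ (by positivity)]
    push_cast; linarith
  have hq0 : 0 < q := by linarith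
  have hqm0 : 0 < qm := by rw [hqm]; positivity
  have hqp1 : 1 ≤ qp := by
    rw [hqp, le_div_iff₀ (by positivity)]; push_cast; linarith
  have hqq : 1 ≤ q / (q - 2) := by rw [le_div_iff₀ hq2]; linarith
  have hsum : qm⁻¹ + qp⁻¹ + (q / (q - 2))⁻¹ = 1 := by
    have e : (q / (q - 2))⁻¹ = 1 - 2 * q⁻¹ := by field_simp
    rw [e, hq, hqm, hqp]
    push_cast
    field_simp
    ring
  set θ : ℝ := min 1 (min (1 / (8 * q)) (η / (8 * q))) with hθ
  have hθ0 : 0 < θ := by positivity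
  have hθ1 : θ ≤ 1 := min_le_left _ _
  have c1 : 2 * q * θ ≤ 1 / 4 := by
    have : θ ≤ 1 / (8 * q) := (min_le_right _ _).trans (min_le_left _ _)
    calc 2 * q * θ ≤ 2 * q * (1 / (8 * q)) := by gcongr
      _ = 1 / 4 := by field_simp; norm_num
  have c2 : 2 * q * θ ≤ η / 4 := by
    have : θ ≤ η / (8 * q) := (min_le_right _ _).trans (min_le_right _ _)
    calc 2 * q * θ ≤ 2 * q * (η / (8 * q)) := by gcongr
      _ = η / 4 := by field_simp; norm_num
  set K : ℝ := (1 / θ ^ 2) ^ qm with hK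
  have hK0 : 0 < K := by positivity
  obtain ⟨ε, hε, H⟩ := ih (1 / (8 * q * K)) (by positivity)
  refine ⟨ε, hε, fun v f hf hb => ?_⟩
  have h0 := H v f hf hb
  have h1 := gn_parts (k := k) (j := i + 2) (by omega) hjk hf v
  rw [hi', ← hq] at h1
  have bm := hf.dk v (i+1)
  have b0 := hf.dk v (i+2)
  have bp := hf.dk v (i+2+1)
  have rm : BC fun z => |dk v (i+1) f z| ^ qm := bm.rpow hqm0.le
  have r0 : BC fun z => |dk v (i+2) f z| ^ q := b0.rpow hq0.le
  have rp : BC fun z => |dk v (i+2+1) f z| ^ qp := bp.rpow (by linarith)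
  have h2 : II (fun z => |dk v (i+1) f (z + v)| * |dk v (i+2+1) f z| *
      (|dk v (i+2) f (z + v)| ^ (q - 2) + |dk v (i+2) f z| ^ (q - 2))) ≤
      II (fun z => (2 * K) * |dk v (i+1) f (z+v)| ^ qm + ((2 * θ) * |dk v (i+2+1) f z| ^ qp +
        (θ * |dk v (i+2) f (z+v)| ^ q + θ * |dk v (i+2) f z| ^ q))) := by
    refine II_mono (((bm.shift v).abs.mul bp.abs).mul
      (((b0.shift v).rpow hq2.le).add (b0.rpow hq2.le)))
      (((rm.shift v).cmul (2*K)).add ((rp.cmul (2*θ)).add (((r0.shift v).cmul θ).add (r0.cmul θ))))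
      fun z => ?_
    have y : ∀ a b c : ℝ, |a| * |b| * |c| ^ (q - 2) ≤ K * |a| ^ qm + θ * |b| ^ qp + θ * |c| ^ q := by
      intro a b c
      have := young3 (a := (1 / θ ^ 2) * |a|) (b := θ * |b|) (c := θ * |c| ^ (q - 2))
        (s := qm) (t := qp) (u := q / (q - 2)) (by positivity) (by positivity) (by positivity)
        hqm0 (by linarith) (by linarith) hsum
      rw [Real.mul_rpow (by positivity) (by positivity),
        Real.mul_rpow hθ0.le (by positivity), Real.mul_rpow hθ0.le (by positivity),
        ← Real.rpow_mul (abs_nonneg c)] at this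
      have e : (q - 2) * (q / (q - 2)) = q := by field_simp
      rw [e, ← hK] at this
      have t1 : θ ^ qp ≤ θ := by
        have := Real.rpow_le_rpow_of_exponent_ge hθ0 hθ1 hqp1
        rwa [Real.rpow_one] at this
      have t2 : θ ^ (q / (q - 2)) ≤ θ := by
        have := Real.rpow_le_rpow_of_exponent_ge hθ0 hθ1 hqq
        rwa [Real.rpow_one] at this
      have t3 := mul_le_mul_of_nonneg_right t1 (Real.rpow_nonneg (abs_nonneg b) qp)
      have t4 := mul_le_mul_of_nonneg_right t2 (Real.rpow_nonneg (abs_nonneg c) q)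
      have t5 : 1 / θ ^ 2 * |a| * (θ * |b|) * (θ * |c| ^ (q - 2)) = |a| * |b| * |c| ^ (q - 2) := by
        field_simp
      linarith
    have y1 := y (dk v (i+1) f (z+v)) (dk v (i+2+1) f z) (dk v (i+2) f (z+v))
    have y2 := y (dk v (i+1) f (z+v)) (dk v (i+2+1) f z) (dk v (i+2) f z)
    rw [mul_add]
    linarith
  rw [II_add ((rm.shift v).cmul (2*K)) ((rp.cmul (2*θ)).add (((r0.shift v).cmul θ).add (r0.cmul θ))),
    II_add (rp.cmul (2*θ)) (((r0.shift v).cmul θ).add (r0.cmul θ)),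
    II_add ((r0.shift v).cmul θ) (r0.cmul θ), II_cmul, II_cmul, II_cmul, II_cmul,
    SS_shift (k := k) (j := i+1) hf v v, SS_shift (k := k) (j := i+2) hf v v] at h2
  change _ ≤ 2 * K * SS k v (i+1) f + (2 * θ * SS k v (i+2+1) f +
    (θ * SS k v (i+2) f + θ * SS k v (i+2) f)) at h2
  have h3 := h1.trans (mul_le_mul_of_nonneg_left h2 hq0.le)
  have n1 := SS_nonneg k v (i+2) f
  have n2 := SS_nonneg k v (i+2+1) f
  have d0 := mul_le_mul_of_nonneg_left h0 (show 0 ≤ 2 * q * K by positivity)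
  have d00 : 2 * q * K * (1 / (8 * q * K) * SS k v (i+2) f) = 1 / 4 * SS k v (i+2) f := by
    field_simp; ring
  have d1 := mul_le_mul_of_nonneg_right c1 n1
  have d2 := mul_le_mul_of_nonneg_right c2 n2
  nlinarith

lemma gn_all {k : ℕ} (j : ℕ) (hj : 1 ≤ j) (hjk : j < k) :
    ∀ η > 0, ∃ ε > 0, ∀ (v : ℝ × ℝ) (f : ℝ × ℝ → ℝ), BC f →
      (∀ z, |f z| ≤ ε) → SS k v j f ≤ η * SS k v (j+1) f := by
  induction j, hj using Nat.le_induction with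
  | base => exact gn_base hjk
  | succ j hj ih => exact gn_step (by omega) hjk (ih (by omega))

lemma gn_top {k : ℕ} (n : ℕ) : ∀ j : ℕ, 1 ≤ j → j < k → k = j + 1 + n →
    ∀ η > 0, ∃ ε > 0, ∀ (v : ℝ × ℝ) (f : ℝ × ℝ → ℝ), BC f →
      (∀ z, |f z| ≤ ε) → SS k v j f ≤ η * SS k v k f := by
  induction n with
  | zero =>
    intro j hj hjk hn η hη
    have := gn_all j hj hjk η hη
    rw [show j + 1 = k by omega] at this
    exact this
  | succ n ih =>
    intro j hj hjk hn η hη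
    obtain ⟨ε, hε, H⟩ := gn_all j hj hjk η hη
    obtain ⟨ε', hε', H'⟩ := ih (j+1) (by omega) (by omega) (by omega) 1 one_pos
    refine ⟨min ε ε', by positivity, fun v f hf hb => ?_⟩
    have h1 := H v f hf fun z => (hb z).trans (min_le_left _ _)
    have h2 := H' v f hf fun z => (hb z).trans (min_le_right _ _)
    rw [one_mul] at h2
    exact h1.trans (mul_le_mul_of_nonneg_left h2 hη.le)

lemma gn {k j : ℕ} (hj : 1 ≤ j) (hjk : j < k) :
    ∀ η > 0, ∃ ε > 0, ∀ (v : ℝ × ℝ) (f : ℝ × ℝ → ℝ), BC f →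
      (∀ z, |f z| ≤ ε) → SS k v j f ≤ η * SS k v k f :=
  gn_top (k - (j + 1)) j hj hjk (by omega)

/-! ### Derivatives of periodic functions -/

/-- Directional derivative. -/
noncomputable def dd (e : ℝ × ℝ) (f : ℝ × ℝ → ℝ) (z : ℝ × ℝ) : ℝ := fderiv ℝ f z e

lemma dd_per {f : ℝ × ℝ → ℝ} (hf : Biperiodic f) (e : ℝ × ℝ) : Biperiodic (dd e f) := by
  have key : ∀ w : ℝ × ℝ, (∀ z, f (z + w) = f z) → ∀ z, dd e f (z + w) = dd e f z := by
    intro w hw z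
    unfold dd
    rw [← fderiv_comp_add_right]
    simp only [hw]
  intro x y
  constructor
  · have := key (1, 0) (fun z => by obtain ⟨x', y'⟩ := z; simpa using (hf x' y').1) (x, y)
    simpa using this
  · have := key (0, 1) (fun z => by obtain ⟨x', y'⟩ := z; simpa using (hf x' y').2) (x, y)
    simpa using this

lemma dd_contDiff {f : ℝ × ℝ → ℝ} {n m : WithTop ℕ∞} (hf : ContDiff ℝ n f) (h : m + 1 ≤ n)
    (e : ℝ × ℝ) : ContDiff ℝ m (dd e f) :=
  (hf.fderiv_right h).clm_apply contDiff_const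

lemma dd_BC {f : ℝ × ℝ → ℝ} (hc : ContDiff ℝ 1 f) (hf : Biperiodic f) (e : ℝ × ℝ) :
    BC (dd e f) :=
  ⟨(dd_contDiff (m := 0) hc (by norm_num) e).continuous, dd_per hf e⟩

lemma fwd_contDiff {f : ℝ × ℝ → ℝ} {n : WithTop ℕ∞} (hf : ContDiff ℝ n f) (v : ℝ × ℝ) :
    ContDiff ℝ n (fwdDiff v f) :=
  (hf.comp (contDiff_id.add contDiff_const)).sub hf

lemma dk_contDiff {f : ℝ × ℝ → ℝ} {n : WithTop ℕ∞} (hf : ContDiff ℝ n f) (v : ℝ × ℝ) (k : ℕ) :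
    ContDiff ℝ n (dk v k f) := by
  induction k with
  | zero => exact hf
  | succ k ih => rw [dk_succ]; exact fwd_contDiff ih v

lemma dd_fwd {f : ℝ × ℝ → ℝ} (hf : ContDiff ℝ 1 f) (e v : ℝ × ℝ) :
    dd e (fwdDiff v f) = fwdDiff v (dd e f) := by
  funext z
  have hd : Differentiable ℝ f := hf.differentiable (by norm_num)
  have hd' : Differentiable ℝ fun z => f (z + v) := hd.comp (differentiable_id.add_const v)
  have : fwdDiff v f = (fun z => f (z + v)) - f := rfl
  rw [fwd_apply]
  unfold dd
  rw [this, fderiv_sub (hd' z) (hd z), fderiv_comp_add_right]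
  rfl

lemma dd_dk {f : ℝ × ℝ → ℝ} (hf : ContDiff ℝ 1 f) (e v : ℝ × ℝ) (k : ℕ) :
    dd e (dk v k f) = dk v k (dd e f) := by
  induction k with
  | zero => rfl
  | succ k ih => rw [dk_succ, dk_succ, dd_fwd (dk_contDiff hf v k), ih]

lemma line_deriv {f : ℝ × ℝ → ℝ} (hf : ContDiff ℝ 1 f) (e z : ℝ × ℝ) (t : ℝ) :
    HasDerivAt (fun t : ℝ => f (z + t • e)) (dd e f (z + t • e)) t := by
  have h1 : HasFDerivAt f (fderiv ℝ f (z + t • e)) (z + t • e) :=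
    (hf.differentiable (by norm_num) _).hasFDerivAt
  have h2 : HasDerivAt (fun t : ℝ => z + t • e) e t := by
    simpa using ((hasDerivAt_id t).smul_const e).const_add z
  exact h1.comp_hasDerivAt t h2

lemma fwd_eq_int {f : ℝ × ℝ → ℝ} (hf : ContDiff ℝ 1 f) (e z : ℝ × ℝ) (h : ℝ) :
    fwdDiff (h • e) f z = ∫ t in (0:ℝ)..h, dd e f (z + t • e) := by
  have hc : Continuous (dd e f) := (dd_contDiff (m := 0) hf (by norm_num) e).continuous
  have := intervalIntegral.integral_eq_sub_of_hasDerivAt (a := 0) (b := h)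
    (fun t _ => line_deriv hf e z t)
    ((hc.comp (by fun_prop : Continuous fun t : ℝ => z + t • e)).intervalIntegrable _ _)
  rw [fwd_apply, this]
  simp

lemma fwd_sup {f : ℝ × ℝ → ℝ} (hf : ContDiff ℝ 1 f) (e : ℝ × ℝ) {C : ℝ}
    (hC : ∀ z, |dd e f z| ≤ C) {h : ℝ} (hh : 0 ≤ h) (z : ℝ × ℝ) :
    |fwdDiff (h • e) f z| ≤ C * h := by
  rw [fwd_eq_int hf]
  have := intervalIntegral.norm_integral_le_of_norm_le_const (a := 0) (b := h)
    (f := fun t => dd e f (z + t • e)) (C := C) (fun t _ => hC _)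
  simpa [abs_of_nonneg hh] using this

lemma smooth_bound (e : ℝ × ℝ) (k : ℕ) : ∀ G : ℝ × ℝ → ℝ, ContDiff ℝ (⊤ : ℕ∞) G → Biperiodic G →
    ∃ C, 0 < C ∧ ∀ h : ℝ, 0 ≤ h → ∀ z, |dk (h • e) k G z| ≤ C * h ^ k := by
  induction k with
  | zero =>
    intro G hG hp
    obtain ⟨C, hC, H⟩ := BC.bdd ⟨hG.continuous, hp⟩
    exact ⟨C, hC, fun h _ z => by simpa [dk_zero] using H z⟩
  | succ k ih =>
    intro G hG hp
    have hG1 : ContDiff ℝ 1 G := hG.of_le (by exact_mod_cast le_top)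
    obtain ⟨C, hC, H⟩ := ih (dd e G) (dd_contDiff hG (by exact_mod_cast le_top) e) (dd_per hp e)
    refine ⟨C, hC, fun h hh z => ?_⟩
    rw [dk_succ]
    have := fwd_sup (dk_contDiff hG1 (h • e) k) e (C := C * h ^ k)
      (fun z => by rw [dd_dk hG1]; exact H h hh z) hh z
    calc _ ≤ _ := this
      _ = _ := by ring

lemma II_swap {g : ℝ × ℝ → ℝ} (hg : BC g) (e : ℝ × ℝ) (h : ℝ) :
    II (fun z => ∫ t in (0:ℝ)..h, g (z + t • e)) = h * II g := by
  unfold II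
  obtain ⟨C, hC, H⟩ := hg.bdd
  have hcont : Continuous fun x : ℝ × UnitAddTorus (Fin 2) => g (rep x.2 + x.1 • e) := by
    have : ∀ x : ℝ × UnitAddTorus (Fin 2), g (rep x.2 + x.1 • e) =
        g (rep (x.2 + proj (x.1 • e))) := fun x =>
      bip_congr hg.per (by rw [proj_add, proj_rep, proj_rep])
    simp only [this]
    exact hg.rep_cont.comp (continuous_snd.add
      (continuous_proj.comp (continuous_fst.smul continuous_const)))
  have := intervalIntegral_integral_swap (a := 0) (b := h) (μ := muT)
    (f := fun t τ => g (rep τ + t • e)) (by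
      haveI : IsFiniteMeasure (volume.restrict (Set.uIoc (0:ℝ) h)) := by
        unfold Set.uIoc; infer_instance
      refine Integrable.of_bound hcont.aestronglyMeasurable C ?_
      filter_upwards with x using H _)
  rw [← this]
  have h2 : ∀ t : ℝ, ∫ τ, g (rep τ + t • e) ∂muT = II g := fun t => II_shift hg (t • e)
  simp only [h2]
  simp [II]

lemma II_dd {f : ℝ × ℝ → ℝ} (hc : ContDiff ℝ 1 f) (hf : Biperiodic f) (e : ℝ × ℝ) :
    II (dd e f) = 0 := by
  have hB : BC f := ⟨hc.continuous, hf⟩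
  have h1 := II_swap (dd_BC hc hf e) e 1
  have h2 : II (fun z => ∫ t in (0:ℝ)..1, dd e f (z + t • e)) = 0 := by
    have : (fun z => ∫ t in (0:ℝ)..1, dd e f (z + t • e)) = fun z => f (z + (1:ℝ) • e) - f z := by
      funext z; rw [← fwd_eq_int hc]; rfl
    rw [this, II_sub (hB.shift _) hB, II_shift hB]; ring
  linarith

lemma II_fwd_sq {f : ℝ × ℝ → ℝ} (hc : ContDiff ℝ 1 f) (hf : Biperiodic f) (e : ℝ × ℝ)
    {h : ℝ} (hh : 0 ≤ h) :
    II (fun z => fwdDiff (h • e) f z ^ 2) ≤ h ^ 2 * II (fun z => dd e f z ^ 2) := by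
  have hB : BC f := ⟨hc.continuous, hf⟩
  have hD := dd_BC hc hf e
  have hsq := hD.sq
  have hsw := II_swap hsq e h
  have e1 : h ^ 2 * II (fun z => dd e f z ^ 2) =
      II (fun z => h * ∫ t in (0:ℝ)..h, dd e f (z + t • e) ^ 2) := by
    rw [II_cmul, hsw]; ring
  rw [e1]
  have bI : BC fun z => ∫ t in (0:ℝ)..h, dd e f (z + t • e) ^ 2 := by
    constructor
    · refine intervalIntegral.continuous_parametric_intervalIntegral_of_continuous' ?_ 0 h
      have := hsq.cont
      exact this.comp (by fun_prop : Continuous fun x : (ℝ × ℝ) × ℝ => x.1 + x.2 • e)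
    · intro x y
      have := fun t : ℝ => (hsq.shift (t • e)).per x y
      simp only [(this _).1, (this _).2, and_self]
  refine II_mono (hB.fwd _).sq (bI.cmul h) fun z => ?_
  rw [fwd_eq_int hc]
  set g : ℝ → ℝ := fun t => dd e f (z + t • e) with hg
  have gc : Continuous g := hD.cont.comp (by fun_prop : Continuous fun t : ℝ => z + t • e)
  change (∫ t in (0:ℝ)..h, g t) ^ 2 ≤ h * ∫ t in (0:ℝ)..h, g t ^ 2
  rcases eq_or_lt_of_le hh with h0 | h0
  · simp [← h0]
  set m := (∫ t in (0:ℝ)..h, g t) with hm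
  have hn : 0 ≤ ∫ t in (0:ℝ)..h, (g t - m / h) ^ 2 :=
    intervalIntegral.integral_nonneg hh fun t _ => sq_nonneg _
  have ex : (∫ t in (0:ℝ)..h, (g t - m / h) ^ 2) = (∫ t in (0:ℝ)..h, g t ^ 2) - m ^ 2 / h := by
    have : ∀ t, (g t - m / h) ^ 2 = g t ^ 2 - (2 * m / h) * g t + (m / h) ^ 2 := fun t => by ring
    simp only [this]
    rw [intervalIntegral.integral_add, intervalIntegral.integral_sub,
      intervalIntegral.integral_const_mul, ← hm, intervalIntegral.integral_const]
    · simp; field_simp; ring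
    all_goals exact Continuous.intervalIntegrable (by fun_prop) _ _
  rw [ex] at hn
  have := mul_nonneg hh hn
  have e3 : h * ((∫ t in (0:ℝ)..h, g t ^ 2) - m ^ 2 / h) = h * (∫ t in (0:ℝ)..h, g t ^ 2) - m ^ 2 := by
    field_simp
  linarith

lemma dd_mul {f g : ℝ × ℝ → ℝ} (hf : ContDiff ℝ 1 f) (hg : ContDiff ℝ 1 g) (e z : ℝ × ℝ) :
    dd e (fun z => f z * g z) z = dd e f z * g z + f z * dd e g z := by
  have h1 := hf.differentiable (by norm_num) z
  have h2 := hg.differentiable (by norm_num) z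
  unfold dd
  have : (fun z => f z * g z) = f * g := rfl
  rw [this, fderiv_mul h1 h2]
  simp; ring

lemma dd_comm {w : ℝ × ℝ → ℝ} (hw : ContDiff ℝ 2 w) (e e' : ℝ × ℝ) :
    dd e (dd e' w) = dd e' (dd e w) := by
  funext z
  have hs : IsSymmSndFDerivAt ℝ w z := hw.contDiffAt.isSymmSndFDerivAt (by simp)
  have hd : DifferentiableAt ℝ (fderiv ℝ w) z :=
    (hw.fderiv_right (m := 1) (by norm_num)).differentiable (by norm_num) z
  have key : ∀ a b : ℝ × ℝ, dd a (dd b w) z = fderiv ℝ (fderiv ℝ w) z a b := by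
    intro a b
    have : dd b w = fun y => fderiv ℝ w y b := rfl
    unfold dd
    rw [fderiv_clm_apply hd (differentiableAt_const b)]
    simp
  rw [key, key]
  exact hs.eq _ _

lemma II_det_aux {w : ℝ × ℝ → ℝ} (hw : ContDiff ℝ 2 w) (hp : Biperiodic w) (e e' v : ℝ × ℝ) :
    II (fun z => dd e (dd e w) z * fwdDiff v (dd e' w) z) =
      II (fun z => dd e' (dd e w) (z + v) * fwdDiff v (dd e w) z) := by
  have cx : ContDiff ℝ 1 (dd e w) := dd_contDiff hw (by norm_num) e
  have cy : ContDiff ℝ 1 (dd e' w) := dd_contDiff hw (by norm_num) e'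
  have px := dd_per hp e
  have py := dd_per hp e'
  have bx : BC (dd e w) := ⟨cx.continuous, px⟩
  have by' : BC (dd e' w) := ⟨cy.continuous, py⟩
  have cyv := fwd_contDiff cy v
  have bq : BC (dd e' (dd e w)) := dd_BC cx px e'
  have bxx : BC (dd e (dd e w)) := dd_BC cx px e
  have h0 := II_dd (f := fun z => dd e w z * fwdDiff v (dd e' w) z) (cx.mul cyv)
    (bx.mul (by'.fwd v)).per e
  have h1 : dd e (fun z => dd e w z * fwdDiff v (dd e' w) z) =
      fun z => dd e (dd e w) z * fwdDiff v (dd e' w) z +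
        fwdDiff v (dd e' (dd e w)) z * dd e w z := by
    funext z
    rw [dd_mul cx cyv, dd_fwd cy, dd_comm hw e e']; ring
  rw [h1, II_add (bxx.mul (by'.fwd v)) ((bq.fwd v).mul bx), II_fwd_mul bq bx] at h0
  linarith

lemma II_det {w : ℝ × ℝ → ℝ} (hw : ContDiff ℝ 2 w) (hp : Biperiodic w) (e e' : ℝ × ℝ) :
    II (fun z => dd e (dd e w) z * dd e' (dd e' w) z) = II (fun z => dd e' (dd e w) z ^ 2) := by
  have cx : ContDiff ℝ 1 (dd e w) := dd_contDiff hw (by norm_num) e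
  have cy : ContDiff ℝ 1 (dd e' w) := dd_contDiff hw (by norm_num) e'
  have px := dd_per hp e
  have py := dd_per hp e'
  have bx : BC (dd e w) := ⟨cx.continuous, px⟩
  have by' : BC (dd e' w) := ⟨cy.continuous, py⟩
  have bq : BC (dd e' (dd e w)) := dd_BC cx px e'
  have bxx : BC (dd e (dd e w)) := dd_BC cx px e
  have byy : BC (dd e' (dd e' w)) := dd_BC cy py e'
  set u : ℕ → ℝ := fun n => 1 / ((n:ℝ) + 1) with hu
  have hu0 : ∀ n, 0 < u n := fun n => by simp only [hu]; positivity
  have hlim : Filter.Tendsto u Filter.atTop (nhds 0) := tendsto_one_div_add_atTop_nhds_zero_nat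
  have hlim' : Filter.Tendsto u Filter.atTop (nhdsWithin 0 {0}ᶜ) :=
    tendsto_nhdsWithin_iff.2 ⟨hlim, Filter.Eventually.of_forall fun n => (hu0 n).ne'⟩
  have slope : ∀ {f : ℝ × ℝ → ℝ}, ContDiff ℝ 1 f → ∀ z,
      Filter.Tendsto (fun n => (u n)⁻¹ * fwdDiff (u n • e') f z) Filter.atTop
        (nhds (dd e' f z)) := by
    intro f hf z
    have := line_deriv hf e' z 0
    rw [hasDerivAt_iff_tendsto_slope_zero] at this
    have := this.comp hlim'
    simpa [Function.comp_def, fwd_apply] using this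
  have bound : ∀ {f : ℝ × ℝ → ℝ}, ContDiff ℝ 1 f → ∀ C : ℝ, (∀ z, |dd e' f z| ≤ C) → ∀ n z,
      |(u n)⁻¹ * fwdDiff (u n • e') f z| ≤ C := by
    intro f hf C hC n z
    have := fwd_sup hf e' hC (hu0 n).le z
    rw [abs_mul, abs_of_pos (inv_pos.2 (hu0 n)), inv_mul_le_iff₀ (hu0 n)]
    linarith
  obtain ⟨C1, hC1, H1⟩ := bxx.bdd
  obtain ⟨C2, hC2, H2⟩ := byy.bdd
  obtain ⟨C3, hC3, H3⟩ := bq.bdd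
  have L1 : Filter.Tendsto (fun n => II (fun z => dd e (dd e w) z *
      ((u n)⁻¹ * fwdDiff (u n • e') (dd e' w) z))) Filter.atTop
      (nhds (II (fun z => dd e (dd e w) z * dd e' (dd e' w) z))) := by
    refine tendsto_integral_of_dominated_convergence (fun _ => C1 * C2) ?_ (integrable_const _) ?_ ?_
    · intro n
      exact (bxx.mul ((by'.fwd _).cmul _)).rep_cont.aestronglyMeasurable
    · intro n
      filter_upwards with t
      rw [Real.norm_eq_abs, abs_mul]
      exact mul_le_mul (H1 _) (bound cy C2 H2 n _) (abs_nonneg _) hC1.le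
    · filter_upwards with t
      exact tendsto_const_nhds.mul (slope cy _)
  have L2 : Filter.Tendsto (fun n => II (fun z => dd e' (dd e w) (z + u n • e') *
      ((u n)⁻¹ * fwdDiff (u n • e') (dd e w) z))) Filter.atTop
      (nhds (II (fun z => dd e' (dd e w) z ^ 2))) := by
    refine tendsto_integral_of_dominated_convergence (fun _ => C3 * C3) ?_ (integrable_const _) ?_ ?_
    · intro n
      exact ((bq.shift _).mul ((bx.fwd _).cmul _)).rep_cont.aestronglyMeasurable
    · intro n
      filter_upwards with t
      rw [Real.norm_eq_abs, abs_mul]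
      exact mul_le_mul (H3 _) (bound cx C3 H3 n _) (abs_nonneg _) hC3.le
    · filter_upwards with t
      rw [sq]
      refine Filter.Tendsto.mul ?_ (slope cx _)
      have : Filter.Tendsto (fun n => rep t + u n • e') Filter.atTop (nhds (rep t + (0:ℝ) • e')) :=
        tendsto_const_nhds.add (hlim.smul_const e')
      rw [zero_smul, add_zero] at this
      exact (bq.cont.tendsto _).comp this
  refine tendsto_nhds_unique L1 ?_
  refine L2.congr fun n => ?_
  have := II_det_aux hw hp e e' (u n • e')
  have r1 : (fun z => dd e' (dd e w) (z + u n • e') *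
      ((u n)⁻¹ * fwdDiff (u n • e') (dd e w) z)) = fun z => (u n)⁻¹ *
      (dd e' (dd e w) (z + u n • e') * fwdDiff (u n • e') (dd e w) z) := by
    funext z; ring
  have r2 : (fun z => dd e (dd e w) z * ((u n)⁻¹ * fwdDiff (u n • e') (dd e' w) z)) =
      fun z => (u n)⁻¹ * (dd e (dd e w) z * fwdDiff (u n • e') (dd e' w) z) := by
    funext z; ring
  rw [r1, r2, II_cmul, II_cmul, this]

/-! ### Fourier series on the torus -/

/-- The phase of the `n`-th character. -/
noncomputable def theta (n : Fin 2 → ℤ) : ℝ × ℝ →L[ℝ] ℝ :=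
  (2 * Real.pi * n 0) • ContinuousLinearMap.fst ℝ ℝ ℝ +
    (2 * Real.pi * n 1) • ContinuousLinearMap.snd ℝ ℝ ℝ

lemma theta_apply (n : Fin 2 → ℤ) (z : ℝ × ℝ) :
    theta n z = 2 * Real.pi * n 0 * z.1 + 2 * Real.pi * n 1 * z.2 := by
  simp [theta]

lemma theta_norm (n : Fin 2 → ℤ) : ‖theta n‖ ≤ 4 * Real.pi * ‖n‖ := by
  refine ContinuousLinearMap.opNorm_le_bound _ (by positivity) fun z => ?_
  rw [theta_apply]
  have h0 : |(n 0 : ℝ)| ≤ ‖n‖ := norm_le_pi_norm n 0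
  have h1 : |(n 1 : ℝ)| ≤ ‖n‖ := norm_le_pi_norm n 1
  have z0 : |z.1| ≤ ‖z‖ := norm_fst_le z
  have z1 : |z.2| ≤ ‖z‖ := norm_snd_le z
  have a0 : |(n 0 : ℝ)| * |z.1| ≤ ‖n‖ * ‖z‖ := mul_le_mul h0 z0 (abs_nonneg _) (norm_nonneg _)
  have a1 : |(n 1 : ℝ)| * |z.2| ≤ ‖n‖ * ‖z‖ := mul_le_mul h1 z1 (abs_nonneg _) (norm_nonneg _)
  have hpi := Real.pi_pos
  calc ‖2 * Real.pi * n 0 * z.1 + 2 * Real.pi * n 1 * z.2‖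
      ≤ ‖2 * Real.pi * n 0 * z.1‖ + ‖2 * Real.pi * n 1 * z.2‖ := norm_add_le _ _
    _ = 2 * Real.pi * (|(n 0 : ℝ)| * |z.1|) + 2 * Real.pi * (|(n 1 : ℝ)| * |z.2|) := by
        simp only [norm_mul, Real.norm_eq_abs, abs_of_pos hpi, abs_two]; ring
    _ ≤ 2 * Real.pi * (‖n‖ * ‖z‖) + 2 * Real.pi * (‖n‖ * ‖z‖) := by gcongr
    _ = _ := by ring

lemma mF_proj (n : Fin 2 → ℤ) (z : ℝ × ℝ) :
    UnitAddTorus.mFourier n (proj z) = Complex.exp ((theta n z : ℝ) * Complex.I) := by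
  rw [theta_apply]
  simp only [UnitAddTorus.mFourier, proj, ContinuousMap.coe_mk, Fin.prod_univ_two,
    Matrix.cons_val_zero, Matrix.cons_val_one]
  rw [fourier_coe_apply, fourier_coe_apply, ← Complex.exp_add]
  congr 1
  push_cast
  ring

lemma mF_add (n : Fin 2 → ℤ) (s t : UnitAddTorus (Fin 2)) :
    UnitAddTorus.mFourier n (s + t) = UnitAddTorus.mFourier n s * UnitAddTorus.mFourier n t := by
  rw [← proj_rep s, ← proj_rep t, ← proj_add, mF_proj, mF_proj, mF_proj, ← Complex.exp_add]
  rw [map_add]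
  push_cast
  ring_nf

lemma expI_contDiff : ContDiff ℝ (⊤ : ℕ∞) fun t : ℝ => Complex.exp (t * Complex.I) := by
  have : ContDiff ℝ (⊤ : ℕ∞) (fun t : ℝ => (t : ℂ)) := Complex.ofRealCLM.contDiff
  exact (this.mul contDiff_const).cexp

lemma expI_iter (k : ℕ) : iteratedDeriv k (fun t : ℝ => Complex.exp (t * Complex.I)) =
    fun t : ℝ => Complex.I ^ k * Complex.exp (t * Complex.I) := by
  induction k with
  | zero => simp
  | succ k ih =>
    rw [iteratedDeriv_succ, ih]
    funext t
    have h1 : HasDerivAt (fun t : ℝ => (t : ℂ) * Complex.I) (1 * Complex.I) t :=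
      (Complex.ofRealCLM.hasDerivAt (x := t)).mul_const _
    have := (h1.cexp.const_mul (Complex.I ^ k)).deriv
    rw [this]; ring

lemma char_contDiff (n : Fin 2 → ℤ) :
    ContDiff ℝ (⊤ : ℕ∞) fun z : ℝ × ℝ => UnitAddTorus.mFourier n (proj z) := by
  simp only [mF_proj]
  exact expI_contDiff.comp (theta n).contDiff

lemma char_iter (n : Fin 2 → ℤ) (k : ℕ) (z : ℝ × ℝ) :
    ‖iteratedFDeriv ℝ k (fun z : ℝ × ℝ => UnitAddTorus.mFourier n (proj z)) z‖ ≤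
      (4 * Real.pi * ‖n‖) ^ k := by
  have : (fun z : ℝ × ℝ => UnitAddTorus.mFourier n (proj z)) =
      (fun t : ℝ => Complex.exp (t * Complex.I)) ∘ (theta n) := by
    funext z; rw [mF_proj]; rfl
  rw [this, (theta n).iteratedFDeriv_comp_right expI_contDiff z (by exact_mod_cast le_top)]
  refine (ContinuousMultilinearMap.norm_compContinuousLinearMap_le _ _).trans ?_
  rw [norm_iteratedFDeriv_eq_norm_iteratedDeriv, expI_iter]
  simp only [norm_mul, norm_pow, Complex.norm_I, one_pow, Complex.norm_exp_ofReal_mul_I, one_mul,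
    Finset.prod_const, Finset.card_univ, Fintype.card_fin]
  exact pow_le_pow_left₀ (norm_nonneg _) (theta_norm n) k

/-- Uniform approximation by smooth periodic functions. -/
lemma smooth_approx {f : ℝ × ℝ → ℝ} (hf : BC f) {ε : ℝ} (hε : 0 < ε) :
    ∃ G : ℝ × ℝ → ℝ, ContDiff ℝ (⊤ : ℕ∞) G ∧ Biperiodic G ∧ ∀ z, |f z - G z| ≤ ε := by
  let fT : C(UnitAddTorus (Fin 2), ℂ) :=
    ⟨fun t => (f (rep t) : ℂ), Complex.continuous_ofReal.comp hf.rep_cont⟩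
  have hmem : fT ∈ (Submodule.span ℂ (Set.range
      (UnitAddTorus.mFourier (d := Fin 2)))).topologicalClosure := by
    rw [UnitAddTorus.span_mFourier_closure_eq_top]; trivial
  rw [← SetLike.mem_coe, Submodule.topologicalClosure_coe, Metric.mem_closure_iff] at hmem
  obtain ⟨q, hq, hd⟩ := hmem ε hε
  have hsm : ContDiff ℝ (⊤ : ℕ∞) fun z : ℝ × ℝ => q (proj z) := by
    refine Submodule.span_induction (p := fun q _ => ContDiff ℝ (⊤ : ℕ∞) fun z : ℝ × ℝ => q (proj z))
      ?_ ?_ ?_ ?_ hq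
    · rintro _ ⟨n, rfl⟩
      exact char_contDiff n
    · exact contDiff_const
    · intro x y _ _ hx hy
      exact hx.add hy
    · intro c x _ hx
      exact contDiff_const.mul hx
  refine ⟨fun z => (q (proj z)).re, Complex.reCLM.contDiff.comp hsm, ?_, ?_⟩
  · intro x y
    have e1 : proj (x + 1, y) = proj (x, y) := by
      funext i; fin_cases i <;> simp [proj]
    have e2 : proj (x, y + 1) = proj (x, y) := by
      funext i; fin_cases i <;> simp [proj]
    exact ⟨congrArg (fun t => (q t).re) e1, congrArg (fun t => (q t).re) e2⟩
  · intro z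
    have h1 := ContinuousMap.dist_apply_le_dist (f := fT) (g := q) (proj z)
    have h2 : fT (proj z) = (f z : ℂ) := by
      change ((f (rep (proj z)) : ℝ) : ℂ) = _
      rw [hf.rep_proj]
    rw [h2, dist_eq_norm] at h1
    have h3 := Complex.abs_re_le_norm ((f z : ℂ) - q (proj z))
    rw [Complex.sub_re, Complex.ofReal_re] at h3
    linarith

/-- Fourier coefficients. -/
noncomputable def JJ (n : Fin 2 → ℤ) (f : ℝ × ℝ → ℝ) : ℂ :=
  ∫ t, UnitAddTorus.mFourier (-n) t * (f (rep t) : ℂ) ∂muT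

lemma JJ_integrable {f : ℝ × ℝ → ℝ} (hf : BC f) (n : Fin 2 → ℤ) :
    Integrable (fun t => UnitAddTorus.mFourier (-n) t * (f (rep t) : ℂ)) muT :=
  Continuous.integrable_of_hasCompactSupport
    ((UnitAddTorus.mFourier (-n)).continuous.mul (Complex.continuous_ofReal.comp hf.rep_cont))
    (HasCompactSupport.of_compactSpace _)

lemma JJ_fwd {f : ℝ × ℝ → ℝ} (hf : BC f) (n : Fin 2 → ℤ) (v : ℝ × ℝ) :
    JJ n (fwdDiff v f) = (UnitAddTorus.mFourier (-n) (-proj v) - 1) * JJ n f := by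
  have h1 : JJ n (fwdDiff v f) = JJ n (fun z => f (z + v)) - JJ n f := by
    unfold JJ
    rw [← integral_sub (JJ_integrable (hf.shift v) n) (JJ_integrable hf n)]
    congr 1
    funext t
    rw [fwd_apply]; push_cast; ring
  have h2 : JJ n (fun z => f (z + v)) = UnitAddTorus.mFourier (-n) (-proj v) * JJ n f := by
    unfold JJ
    rw [← integral_const_mul]
    rw [← integral_add_right_eq_self (μ := muT) (fun t => UnitAddTorus.mFourier (-n) (-proj v) *
      (UnitAddTorus.mFourier (-n) t * (f (rep t) : ℂ))) (proj v)]
    congr 1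
    funext t
    have e1 : f (rep t + v) = f (rep (t + proj v)) :=
      bip_congr hf.per (by rw [proj_add, proj_rep, proj_rep])
    simp only [e1]
    rw [← mul_assoc, ← mF_add]
    congr 2
    abel
  rw [h1, h2]; ring

lemma JJ_dk {f : ℝ × ℝ → ℝ} (hf : BC f) (n : Fin 2 → ℤ) (v : ℝ × ℝ) (k : ℕ) :
    JJ n (dk v k f) = (UnitAddTorus.mFourier (-n) (-proj v) - 1) ^ k * JJ n f := by
  induction k with
  | zero => simp [dk_zero]
  | succ k ih => rw [dk_succ, JJ_fwd (hf.dk v k), ih]; ring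

lemma JJ_bound {f : ℝ × ℝ → ℝ} (n : Fin 2 → ℤ) :
    ‖JJ n f‖ ≤ II fun z => |f z| := by
  unfold JJ II
  refine (norm_integral_le_integral_norm _).trans (le_of_eq ?_)
  congr 1
  funext t
  rw [norm_mul, ← proj_rep t, mF_proj, Complex.norm_exp_ofReal_mul_I, one_mul, proj_rep]
  simp

lemma JJ_decay_aux {f : ℝ × ℝ → ℝ} (hf : BC f) (n : Fin 2 → ℤ) (e : ℝ × ℝ) (m : ℤ) (hm : m ≠ 0)
    (hth : theta n e = 2 * Real.pi * m) {C : ℝ} (k : ℕ)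
    (H : ∀ h : ℝ, 0 < h → h ≤ 1 → II (fun z => dk (h • e) k f z ^ 2) ≤ C * h ^ (2 * k)) :
    ‖JJ n f‖ * |(m : ℝ)| ^ k ≤ C + 1 := by
  have hm1 : (1:ℝ) ≤ |(m:ℝ)| := by exact_mod_cast Int.one_le_abs hm
  have hm0 : (0:ℝ) < |(m:ℝ)| := by linarith
  set h : ℝ := 1 / (2 * |(m:ℝ)|) with hh
  have h0 : 0 < h := by positivity
  have h1 : h ≤ 1 := by rw [hh, div_le_one (by positivity)]; linarith
  have hchar : UnitAddTorus.mFourier (-n) (-proj (h • e)) = -1 := by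
    have e1 : -proj (h • e) = proj (-(h • e)) := by
      funext i; fin_cases i <;> simp [proj]
    have e2 : theta (-n) (-(h • e)) = h * (2 * Real.pi * m) := by
      rw [← hth, theta_apply, theta_apply]; simp; ring
    rw [e1, mF_proj, e2, hh]
    rcases le_total 0 (m:ℝ) with hs | hs
    · have : 1 / (2 * |(m:ℝ)|) * (2 * Real.pi * m) = Real.pi := by
        rw [abs_of_nonneg hs] at hm0 ⊢; field_simp
      rw [this, Complex.exp_pi_mul_I]
    · have : 1 / (2 * |(m:ℝ)|) * (2 * Real.pi * m) = -Real.pi := by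
        rw [abs_of_nonpos hs] at hm0 ⊢
        have : (m:ℝ) ≠ 0 := by exact_mod_cast hm
        field_simp
      rw [this]
      push_cast
      rw [neg_mul, Complex.exp_neg, Complex.exp_pi_mul_I]; norm_num
  have hJ := JJ_dk hf n (h • e) k
  rw [hchar] at hJ
  have hn : ‖JJ n (dk (h • e) k f)‖ = 2 ^ k * ‖JJ n f‖ := by
    rw [hJ, norm_mul, norm_pow]; norm_num
  have hB := JJ_bound (f := dk (h • e) k f) n
  have hd := hf.dk (h • e) k
  have hI : II (fun z => |dk (h • e) k f z|) ≤ (C + 1) * h ^ k := by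
    have hk : 0 < h ^ k := by positivity
    calc II (fun z => |dk (h • e) k f z|) ≤ II (fun z => (h ^ k)⁻¹ * dk (h • e) k f z ^ 2 + h ^ k) := by
          refine II_mono hd.abs ((hd.sq.cmul _).add (BC.const _)) fun z => ?_
          set x := dk (h • e) k f z
          set s := h ^ k
          have : 0 ≤ s⁻¹ * (|x| - s) ^ 2 + |x| := by positivity
          have e3 : s⁻¹ * (|x| - s) ^ 2 = s⁻¹ * x ^ 2 - 2 * |x| + s := by
            rw [← sq_abs x]; field_simp; ring
          linarith
      _ = (h ^ k)⁻¹ * II (fun z => dk (h • e) k f z ^ 2) + h ^ k := by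
          rw [II_add (hd.sq.cmul _) (BC.const _), II_cmul, II_const]
      _ ≤ (h ^ k)⁻¹ * (C * h ^ (2 * k)) + h ^ k := by gcongr; exact H h h0 h1
      _ = (C + 1) * h ^ k := by
          rw [two_mul, pow_add]; field_simp
  have : 2 ^ k * ‖JJ n f‖ ≤ (C + 1) * h ^ k := by linarith
  rw [hh, div_pow, mul_pow, one_pow] at this
  have hp : 0 < |(m:ℝ)| ^ k := by positivity
  have h3 : (C + 1) * (1 / (2 ^ k * |(m:ℝ)| ^ k)) * |(m:ℝ)| ^ k ≤ C + 1 := by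
    have hC : 0 ≤ C + 1 := by
      have := II_nonneg (f := fun z => |dk (h • e) k f z|) fun z => abs_nonneg _
      by_contra hneg
      push Not at hneg
      have : (C + 1) * h ^ k < 0 := mul_neg_of_neg_of_pos hneg (by positivity)
      linarith
    have h4 : (C + 1) * (1 / (2 ^ k * |(m:ℝ)| ^ k)) * |(m:ℝ)| ^ k = (C + 1) * (1 / 2 ^ k) := by
      field_simp
    rw [h4]
    have : (1:ℝ) / 2 ^ k ≤ 1 := by
      rw [div_le_one (by positivity)]; exact one_le_pow₀ (by norm_num)
    nlinarith
  have h5 : ‖JJ n f‖ ≤ 2 ^ k * ‖JJ n f‖ := by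
    have : (1:ℝ) ≤ 2 ^ k := one_le_pow₀ (by norm_num)
    nlinarith [norm_nonneg (JJ n f)]
  have h6 : ‖JJ n f‖ * |(m:ℝ)| ^ k ≤ (C + 1) * (1 / (2 ^ k * |(m:ℝ)| ^ k)) * |(m:ℝ)| ^ k := by
    gcongr; linarith
  linarith

/-- Integral decay of differences implies smoothness. -/
lemma smooth_of_decay {f : ℝ × ℝ → ℝ} (hf : BC f)
    (H : ∀ k : ℕ, 2 ≤ k → ∀ e : ℝ × ℝ, e = (1, 0) ∨ e = (0, 1) → ∃ C : ℝ, ∀ h : ℝ, 0 < h → h ≤ 1 →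
      II (fun z => dk (h • e) k f z ^ 2) ≤ C * h ^ (2 * k)) :
    ContDiff ℝ (⊤ : ℕ∞) f := by
  have dec : ∀ k : ℕ, 2 ≤ k → ∃ C : ℝ, ∀ n : Fin 2 → ℤ, n ≠ 0 → ‖JJ n f‖ * ‖n‖ ^ k ≤ C := by
    intro k hk
    obtain ⟨C1, H1⟩ := H k hk (1, 0) (Or.inl rfl)
    obtain ⟨C2, H2⟩ := H k hk (0, 1) (Or.inr rfl)
    refine ⟨max (C1 + 1) (C2 + 1), fun n hn => ?_⟩
    have hcase : ‖n‖ = |(n 0 : ℝ)| ∨ ‖n‖ = |(n 1 : ℝ)| := by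
      have h0 : |(n 0 : ℝ)| ≤ ‖n‖ := norm_le_pi_norm n 0
      have h1 : |(n 1 : ℝ)| ≤ ‖n‖ := norm_le_pi_norm n 1
      by_contra hc
      push Not at hc
      have : ‖n‖ < ‖n‖ := by
        have hpos : 0 < ‖n‖ := norm_pos_iff.2 hn
        rw [pi_norm_lt_iff hpos]
        intro i
        fin_cases i
        · exact lt_of_le_of_ne h0 hc.1.symm
        · exact lt_of_le_of_ne h1 hc.2.symm
      exact lt_irrefl _ this
    have hpos : 0 < ‖n‖ := norm_pos_iff.2 hn
    rcases hcase with hc | hc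
    · have hm : n 0 ≠ 0 := by
        intro h0; rw [hc, h0] at hpos; simp at hpos
      rw [hc]
      exact (JJ_decay_aux hf n (1, 0) (n 0) hm (by simp [theta_apply]) k H1).trans (le_max_left _ _)
    · have hm : n 1 ≠ 0 := by
        intro h0; rw [hc, h0] at hpos; simp at hpos
      rw [hc]
      exact (JJ_decay_aux hf n (0, 1) (n 1) hm (by simp [theta_apply]) k H2).trans (le_max_right _ _)
  have hsum : ∀ k : ℕ, Summable fun n : Fin 2 → ℤ => ‖JJ n f‖ * (4 * Real.pi * ‖n‖) ^ k := by
    intro k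
    obtain ⟨C, hC⟩ := dec (k + 3) (by omega)
    have hs := (EisensteinSeries.summable_one_div_norm_rpow (k := 3) (by norm_num)).mul_left
      ((4 * Real.pi) ^ k * C)
    refine Summable.of_norm_bounded_eventually hs ?_
    have : ∀ᶠ n : Fin 2 → ℤ in Filter.cofinite, n ≠ 0 := by
      simp [Filter.eventually_cofinite]
    filter_upwards [this] with n hn
    have hpos : 0 < ‖n‖ := norm_pos_iff.2 hn
    rw [Real.norm_of_nonneg (by positivity), Real.rpow_neg hpos.le]
    have e3 : ‖n‖ ^ (3:ℝ) = ‖n‖ ^ 3 := by exact_mod_cast Real.rpow_natCast ‖n‖ 3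
    rw [e3, ← div_eq_mul_inv, le_div_iff₀ (by positivity)]
    calc ‖JJ n f‖ * (4 * Real.pi * ‖n‖) ^ k * ‖n‖ ^ 3
        = (4 * Real.pi) ^ k * (‖JJ n f‖ * ‖n‖ ^ (k + 3)) := by rw [mul_pow, pow_add]; ring
      _ ≤ _ := by
        have := hC n hn
        gcongr
  let fT : C(UnitAddTorus (Fin 2), ℂ) :=
    ⟨fun t => (f (rep t) : ℂ), Complex.continuous_ofReal.comp hf.rep_cont⟩
  have hco : ∀ n, UnitAddTorus.mFourierCoeff fT n = JJ n f := fun n => rfl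
  have hS : Summable (UnitAddTorus.mFourierCoeff fT) := by
    refine Summable.of_norm ?_
    have := hsum 0
    simpa [hco] using this
  have hrep : ∀ z, HasSum (fun n => JJ n f * UnitAddTorus.mFourier n (proj z)) (f z : ℂ) := by
    intro z
    have := UnitAddTorus.hasSum_mFourier_series_apply_of_summable hS (proj z)
    have h2 : fT (proj z) = (f z : ℂ) := by
      change ((f (rep (proj z)) : ℝ) : ℂ) = _
      rw [hf.rep_proj]
    rw [h2] at this
    exact this
  have hsm : ContDiff ℝ (⊤ : ℕ∞) fun z : ℝ × ℝ => ∑' n, JJ n f * UnitAddTorus.mFourier n (proj z) := by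
    refine contDiff_tsum (𝕜 := ℝ) (v := fun k n => ‖JJ n f‖ * (4 * Real.pi * ‖n‖) ^ k)
      (fun n => contDiff_const.mul (char_contDiff n)) (fun k _ => hsum k) ?_
    intro k n z _
    have e1 : iteratedFDeriv ℝ k (fun z : ℝ × ℝ => JJ n f * UnitAddTorus.mFourier n (proj z)) z =
        JJ n f • iteratedFDeriv ℝ k (fun z : ℝ × ℝ => UnitAddTorus.mFourier n (proj z)) z :=
      iteratedFDeriv_const_smul_apply (a := JJ n f)
        ((char_contDiff n).contDiffAt.of_le (by exact_mod_cast le_top))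
    rw [e1, norm_smul]
    gcongr
    exact char_iter n k z
  have hfe : f = fun z => (∑' n, JJ n f * UnitAddTorus.mFourier n (proj z)).re := by
    funext z
    rw [(hrep z).tsum_eq, Complex.ofReal_re]
  rw [hfe]
  exact Complex.reCLM.contDiff.comp hsm

/-! ### Interpolation -/

lemma SS_top {k : ℕ} (hk : 1 ≤ k) (v : ℝ × ℝ) (f : ℝ × ℝ → ℝ) :
    SS k v k f = II fun z => dk v k f z ^ 2 := by
  unfold SS
  congr 1
  funext z
  have hk' : (k:ℝ) ≠ 0 := by positivity
  have : (2 * k / k : ℝ) = (2:ℕ) := by push_cast; field_simp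
  rw [this, Real.rpow_natCast, sq_abs]

lemma abs_add_rpow_le (a b : ℝ) {r : ℝ} (hr : 0 ≤ r) :
    |a + b| ^ r ≤ 2 ^ r * (|a| ^ r + |b| ^ r) := by
  have h1 : |a + b| ≤ 2 * max |a| |b| := by
    have := abs_add_le a b
    have := le_max_left |a| |b|
    have := le_max_right |a| |b|
    linarith
  have h2 : |a + b| ^ r ≤ (2 * max |a| |b|) ^ r := Real.rpow_le_rpow (abs_nonneg _) h1 hr
  rw [Real.mul_rpow (by norm_num) (by positivity)] at h2
  refine h2.trans ?_
  have ha : 0 ≤ |a| ^ r := by positivity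
  have hb : 0 ≤ |b| ^ r := by positivity
  gcongr
  rcases max_choice |a| |b| with h | h <;> rw [h] <;> linarith

lemma interp {X : ℝ × ℝ → ℝ} (hX : BC X) (e : ℝ × ℝ) {k j : ℕ} (hj : 1 ≤ j) (hjk : j < k)
    {η : ℝ} (hη : 0 < η) : ∃ C : ℝ, ∀ h : ℝ, 0 < h → h ≤ 1 →
      SS k (h • e) j X ≤ η * II (fun z => dk (h • e) k X z ^ 2) + C * h ^ (2 * k) := by
  set r : ℝ := 2 * k / j with hr
  have hr0 : 0 ≤ r := expo_nonneg k j
  have hM : (0:ℝ) < 2 ^ r := by positivity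
  obtain ⟨ε, hε, hgn⟩ := gn hj hjk (η / (2 * 2 ^ r)) (by positivity)
  obtain ⟨G, hG, hGp, hGa⟩ := smooth_approx hX hε
  have hGB : BC G := ⟨hG.continuous, hGp⟩
  obtain ⟨C1, hC1, H1⟩ := smooth_bound e j G hG hGp
  obtain ⟨C2, hC2, H2⟩ := smooth_bound e k G hG hGp
  refine ⟨η * C2 ^ 2 + 2 ^ r * C1 ^ r, fun h h0 _ => ?_⟩
  set v := h • e
  have hX' : BC fun z => X z - G z := hX.sub hGB
  have g1 := hgn v _ hX' hGa
  rw [SS_top (by omega)] at g1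
  have hh : (h ^ j) ^ r = h ^ (2 * k) := by
    rw [← Real.rpow_natCast, ← Real.rpow_mul h0.le, ← Real.rpow_natCast]
    congr 1
    have : (j:ℝ) ≠ 0 := by positivity
    rw [hr]; push_cast; field_simp
  have s1 : SS k v j X ≤ 2 ^ r * (SS k v j (fun z => X z - G z) + C1 ^ r * h ^ (2 * k)) := by
    have bX := (hX'.dk v j).rpow hr0
    calc SS k v j X ≤ II (fun z => 2 ^ r * (|dk v j (fun z => X z - G z) z| ^ r + C1 ^ r * h ^ (2 * k))) := by
          refine II_mono ((hX.dk v j).rpow hr0) ((bX.add (BC.const _)).cmul _) fun z => ?_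
          have e1 : dk v j X z = dk v j (fun z => X z - G z) z + dk v j G z := by
            rw [dk_sub]; ring
          rw [e1]
          refine (abs_add_rpow_le _ _ hr0).trans ?_
          have : |dk v j G z| ^ r ≤ C1 ^ r * h ^ (2 * k) := by
            rw [← hh, ← Real.mul_rpow hC1.le (by positivity)]
            exact Real.rpow_le_rpow (abs_nonneg _) (H1 h h0.le z) hr0
          gcongr
      _ = _ := by
          rw [II_cmul, II_add bX (BC.const _), II_const]; rfl
  have s2 : II (fun z => dk v k (fun z => X z - G z) z ^ 2) ≤
      2 * II (fun z => dk v k X z ^ 2) + 2 * C2 ^ 2 * h ^ (2 * k) := by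
    have bX := (hX.dk v k).sq
    calc II (fun z => dk v k (fun z => X z - G z) z ^ 2)
        ≤ II (fun z => 2 * dk v k X z ^ 2 + 2 * C2 ^ 2 * h ^ (2 * k)) := by
          refine II_mono (hX'.dk v k).sq ((bX.cmul 2).add (BC.const _)) fun z => ?_
          rw [dk_sub]
          have h3 : dk v k G z ^ 2 ≤ C2 ^ 2 * h ^ (2 * k) := by
            have := pow_le_pow_left₀ (abs_nonneg _) (H2 h h0.le z) 2
            rw [sq_abs] at this
            calc _ ≤ _ := this
              _ = _ := by rw [mul_pow, ← pow_mul, mul_comm k 2]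
          nlinarith [sq_nonneg (dk v k X z + dk v k G z)]
      _ = _ := by rw [II_add (bX.cmul 2) (BC.const _), II_const, II_cmul]
  calc SS k v j X ≤ _ := s1
    _ ≤ 2 ^ r * (η / (2 * 2 ^ r) * (2 * II (fun z => dk v k X z ^ 2) + 2 * C2 ^ 2 * h ^ (2 * k)) +
          C1 ^ r * h ^ (2 * k)) := by
        gcongr
        refine g1.trans ?_
        gcongr
    _ = _ := by field_simp; ring

/-- Leibniz remainder. -/
noncomputable def RR (k : ℕ) (v : ℝ × ℝ) (X Y : ℝ × ℝ → ℝ) (z : ℝ × ℝ) : ℝ :=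
  dk v k (fun z => X z * Y z) z - X z * dk v k Y z - Y (z + k • v) * dk v k X z

lemma RR_BC {X Y : ℝ × ℝ → ℝ} (hX : BC X) (hY : BC Y) (k : ℕ) (v : ℝ × ℝ) : BC (RR k v X Y) :=
  (((hX.mul hY).dk v k).sub (hX.mul (hY.dk v k))).sub ((hY.shift _).mul (hX.dk v k))

lemma RR_eq (m : ℕ) (v : ℝ × ℝ) (X Y : ℝ × ℝ → ℝ) (z : ℝ × ℝ) :
    RR (m + 1) v X Y z = ∑ i ∈ Finset.range m, ((m + 1).choose (i + 1) : ℝ) *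
      (dk v (i + 1) X z * dk v (m + 1 - (i + 1)) Y (z + (i + 1) • v)) := by
  unfold RR
  rw [dk_mul, Finset.Nat.sum_antidiagonal_eq_sum_range_succ_mk, Finset.sum_range_succ,
    Finset.sum_range_succ']
  simp [dk_zero]
  ring

lemma prod_young {k j : ℕ} (hj : 1 ≤ j) (hjk : j < k) (x y : ℝ) :
    (x * y) ^ 2 ≤ |x| ^ (2 * k / j : ℝ) + |y| ^ (2 * k / (k - j : ℕ) : ℝ) := by
  have hj0 : (0:ℝ) < j := by positivity
  have hkj : (0:ℝ) < (k - j : ℕ) := by exact_mod_cast Nat.sub_pos_of_lt hjk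
  have hk0 : (0:ℝ) < k := by exact_mod_cast (by omega : 0 < k)
  have hc : ((k - j : ℕ) : ℝ) = k - j := by rw [Nat.cast_sub hjk.le]
  have key : ∀ (x : ℝ) (q : ℕ), (x ^ 2) ^ ((k:ℝ) / q) = |x| ^ (2 * k / q : ℝ) := by
    intro x q
    rw [← sq_abs, ← Real.rpow_natCast, ← Real.rpow_mul (abs_nonneg _)]
    congr 1; push_cast; ring
  rw [mul_pow, ← key, ← key]
  refine young2 (sq_nonneg _) (sq_nonneg _) ?_ ?_ ?_
  all_goals first | positivity | skip
  rw [inv_div, inv_div, hc]; field_simp; ring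

lemma rem_bound {X Y : ℝ × ℝ → ℝ} (hX : BC X) (hY : BC Y) (e : ℝ × ℝ) (m : ℕ)
    {η : ℝ} (hη : 0 < η) : ∃ C : ℝ, ∀ h : ℝ, 0 < h → h ≤ 1 →
      II (fun z => RR (m + 1) (h • e) X Y z ^ 2) ≤
        η * (II (fun z => dk (h • e) (m + 1) X z ^ 2) + II (fun z => dk (h • e) (m + 1) Y z ^ 2)) +
          C * h ^ (2 * (m + 1)) := by
  set ch : ℕ → ℝ := fun i => ((m + 1).choose (i + 1) : ℝ) ^ 2 with hch
  have ch0 : ∀ i, 0 ≤ ch i := fun i => by positivity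
  set S : ℝ := m * ∑ i ∈ Finset.range m, ch i with hS
  have S0 : 0 ≤ S := mul_nonneg (by positivity) (Finset.sum_nonneg fun i _ => ch0 i)
  have hη' : 0 < η / (S + 1) := by positivity
  have hA : ∀ i : ℕ, ∃ C : ℝ, i ∈ Finset.range m → ∀ h : ℝ, 0 < h → h ≤ 1 →
      SS (m + 1) (h • e) (i + 1) X ≤ η / (S + 1) * II (fun z => dk (h • e) (m + 1) X z ^ 2) +
        C * h ^ (2 * (m + 1)) := by
    intro i
    by_cases hi : i ∈ Finset.range m
    · obtain ⟨C, hC⟩ := interp hX e (j := i + 1) (k := m + 1) (by omega)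
        (by rw [Finset.mem_range] at hi; omega) hη'
      exact ⟨C, fun _ => hC⟩
    · exact ⟨0, fun h => absurd h hi⟩
  have hB : ∀ i : ℕ, ∃ C : ℝ, i ∈ Finset.range m → ∀ h : ℝ, 0 < h → h ≤ 1 →
      SS (m + 1) (h • e) (m + 1 - (i + 1)) Y ≤
        η / (S + 1) * II (fun z => dk (h • e) (m + 1) Y z ^ 2) + C * h ^ (2 * (m + 1)) := by
    intro i
    by_cases hi : i ∈ Finset.range m
    · obtain ⟨C, hC⟩ := interp hY e (j := m + 1 - (i + 1)) (k := m + 1)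
        (by rw [Finset.mem_range] at hi; omega) (by omega) hη'
      exact ⟨C, fun _ => hC⟩
    · exact ⟨0, fun h => absurd h hi⟩
  choose CA hCA using hA
  choose CB hCB using hB
  refine ⟨m * ∑ i ∈ Finset.range m, ch i * (CA i + CB i), fun h h0 h1 => ?_⟩
  set v := h • e
  set NX := II (fun z => dk v (m + 1) X z ^ 2) with hNX
  set NY := II (fun z => dk v (m + 1) Y z ^ 2) with hNY
  have NX0 : 0 ≤ NX := II_nonneg fun z => sq_nonneg _
  have NY0 : 0 ≤ NY := II_nonneg fun z => sq_nonneg _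
  have bb : ∀ i ∈ Finset.range m, BC fun z => ch i *
      (|dk v (i + 1) X z| ^ (2 * (m + 1 : ℕ) / (i + 1 : ℕ) : ℝ) +
        |dk v (m + 1 - (i + 1)) Y (z + (i + 1) • v)| ^
          (2 * (m + 1 : ℕ) / (m + 1 - (i + 1) : ℕ) : ℝ)) := fun i _ =>
    (((hX.dk v _).rpow (expo_nonneg _ _)).add
      (((hY.dk v _).shift _).rpow (expo_nonneg _ _))).cmul _
  have step : II (fun z => RR (m + 1) v X Y z ^ 2) ≤
      m * ∑ i ∈ Finset.range m, ch i * (SS (m + 1) v (i + 1) X + SS (m + 1) v (m + 1 - (i + 1)) Y) := by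
    calc II (fun z => RR (m + 1) v X Y z ^ 2)
        ≤ II (fun z => m * ∑ i ∈ Finset.range m, ch i *
            (|dk v (i + 1) X z| ^ (2 * (m + 1 : ℕ) / (i + 1 : ℕ) : ℝ) +
              |dk v (m + 1 - (i + 1)) Y (z + (i + 1) • v)| ^
                (2 * (m + 1 : ℕ) / (m + 1 - (i + 1) : ℕ) : ℝ))) := by
          refine II_mono (RR_BC hX hY _ v).sq ((BC.sum _ bb).cmul _) fun z => ?_
          rw [RR_eq]
          refine sq_sum_le_card_mul_sum_sq.trans ?_
          rw [Finset.card_range]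
          gcongr with i hi
          rw [mul_pow]
          refine mul_le_mul_of_nonneg_left ?_ (ch0 i)
          exact prod_young (by omega) (by rw [Finset.mem_range] at hi; omega) _ _
      _ = _ := by
          rw [II_cmul, II_sum _ bb]
          congr 1
          refine Finset.sum_congr rfl fun i _ => ?_
          rw [II_cmul, II_add ((hX.dk v _).rpow (expo_nonneg _ _))
            (((hY.dk v _).shift _).rpow (expo_nonneg _ _))]
          congr 2
          exact II_shift (((hY.dk v (m + 1 - (i + 1)))).rpow (expo_nonneg (m + 1) (m + 1 - (i + 1)))) _
  calc _ ≤ _ := step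
    _ ≤ m * ∑ i ∈ Finset.range m, ch i * ((η / (S + 1) * NX + CA i * h ^ (2 * (m + 1))) +
          (η / (S + 1) * NY + CB i * h ^ (2 * (m + 1)))) := by
        refine mul_le_mul_of_nonneg_left ?_ (by positivity)
        refine Finset.sum_le_sum fun i hi => ?_
        exact mul_le_mul_of_nonneg_left (add_le_add (hCA i hi h h0 h1) (hCB i hi h h0 h1)) (ch0 i)
    _ = S * (η / (S + 1)) * (NX + NY) +
          (m * ∑ i ∈ Finset.range m, ch i * (CA i + CB i)) * h ^ (2 * (m + 1)) := by
        rw [hS]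
        simp only [Finset.mul_sum, Finset.sum_mul, ← Finset.sum_add_distrib]
        refine Finset.sum_congr rfl fun i _ => ?_
        ring
    _ ≤ _ := by
        have : S * (η / (S + 1)) ≤ η := by
          rw [mul_div_assoc', div_le_iff₀ (by positivity)]
          nlinarith
        gcongr

/-! ### The integral Cordes-type estimate -/

lemma cordes_pt {A B C μ Λ h1 h2 h3 : ℝ} (hμ : 0 < μ) (hA : A ≤ Λ)
    (hQ : ∀ s t : ℝ, μ * (s ^ 2 + t ^ 2) ≤ B * s ^ 2 - 2 * C * s * t + A * t ^ 2) :
    h1 ^ 2 + h3 ^ 2 ≤ Λ ^ 2 / μ ^ 4 * (A * h2 + B * h1 - 2 * C * h3) ^ 2 -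
      2 * Λ / μ * (h1 * h2 - h3 ^ 2) := by
  have hA0 : μ ≤ A := by simpa using hQ 0 1
  have hApos : 0 < A := by linarith
  have hΛ : 0 < Λ := by linarith
  set g := A * h2 + B * h1 - 2 * C * h3 with hg
  have q := hQ h1 h3
  have id1 : g * h1 = A * (h1 * h2 - h3 ^ 2) + (B * h1 ^ 2 - 2 * C * h1 * h3 + A * h3 ^ 2) := by
    rw [hg]; ring
  -- divide by A
  have d1 : h1 * h2 - h3 ^ 2 = (g * h1 - (B * h1 ^ 2 - 2 * C * h1 * h3 + A * h3 ^ 2)) / A := by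
    rw [id1]; field_simp; ring
  have d2 : h1 * h2 - h3 ^ 2 ≤ (g * h1) / A - μ / Λ * (h1 ^ 2 + h3 ^ 2) := by
    rw [d1, sub_div]
    have : μ / Λ * (h1 ^ 2 + h3 ^ 2) ≤ (B * h1 ^ 2 - 2 * C * h1 * h3 + A * h3 ^ 2) / A := by
      rw [le_div_iff₀ hApos]
      calc μ / Λ * (h1 ^ 2 + h3 ^ 2) * A ≤ μ / Λ * (h1 ^ 2 + h3 ^ 2) * Λ := by gcongr
        _ = μ * (h1 ^ 2 + h3 ^ 2) := by field_simp
        _ ≤ _ := q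
    linarith
  have d3 : (g * h1) / A ≤ μ / (2 * Λ) * h1 ^ 2 + Λ / (2 * μ ^ 3) * g ^ 2 := by
    have e1 : (g * h1) / A ≤ |g| * |h1| / μ := by
      calc (g * h1) / A ≤ |g * h1| / A := by gcongr; exact le_abs_self _
        _ ≤ |g * h1| / μ := by gcongr
        _ = _ := by rw [abs_mul]
    refine e1.trans ?_
    have e2 : 0 ≤ μ / (2 * Λ) * (|h1| - Λ / μ ^ 2 * |g|) ^ 2 := by positivity
    have e3 : μ / (2 * Λ) * (|h1| - Λ / μ ^ 2 * |g|) ^ 2 =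
        μ / (2 * Λ) * h1 ^ 2 + Λ / (2 * μ ^ 3) * g ^ 2 - |g| * |h1| / μ := by
      rw [← sq_abs h1, ← sq_abs g]; field_simp; ring
    linarith
  have d4 : μ / (2 * Λ) * (h1 ^ 2 + h3 ^ 2) ≤ Λ / (2 * μ ^ 3) * g ^ 2 - (h1 * h2 - h3 ^ 2) := by
    have : μ / Λ = 2 * (μ / (2 * Λ)) := by field_simp
    rw [this] at d2
    have : 0 ≤ μ / (2 * Λ) * h3 ^ 2 := by positivity
    nlinarith
  have d5 := mul_le_mul_of_nonneg_left d4 (by positivity : 0 ≤ 2 * Λ / μ)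
  calc h1 ^ 2 + h3 ^ 2 = 2 * Λ / μ * (μ / (2 * Λ) * (h1 ^ 2 + h3 ^ 2)) := by field_simp
    _ ≤ _ := d5
    _ = _ := by field_simp

lemma cordes {w A B C : ℝ × ℝ → ℝ} (hw : ContDiff ℝ 2 w) (hwp : Biperiodic w)
    (hA : BC A) (hB : BC B) (hC : BC C) {μ Λ : ℝ} (hμ : 0 < μ) (hAΛ : ∀ z, A z ≤ Λ)
    (hBΛ : ∀ z, B z ≤ Λ)
    (hQ : ∀ z, ∀ s t : ℝ, μ * (s ^ 2 + t ^ 2) ≤ B z * s ^ 2 - 2 * C z * s * t + A z * t ^ 2) :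
    II (fun z => dd (1, 0) (dd (1, 0) w) z ^ 2) + II (fun z => dd (0, 1) (dd (0, 1) w) z ^ 2) +
      II (fun z => dd (0, 1) (dd (1, 0) w) z ^ 2) ≤
    2 * Λ ^ 2 / μ ^ 4 * II (fun z => (A z * dd (0, 1) (dd (0, 1) w) z +
      B z * dd (1, 0) (dd (1, 0) w) z - 2 * C z * dd (0, 1) (dd (1, 0) w) z) ^ 2) := by
  have cx : ContDiff ℝ 1 (dd (1, 0) w) := dd_contDiff hw (by norm_num) _
  have cy : ContDiff ℝ 1 (dd (0, 1) w) := dd_contDiff hw (by norm_num) _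
  have b1 := dd_BC cx (dd_per hwp _) (1, 0)
  have b2 := dd_BC cy (dd_per hwp _) (0, 1)
  have b3 := dd_BC cx (dd_per hwp _) (0, 1)
  have hdet := II_det hw hwp (1, 0) (0, 1)
  set h1 := dd (1, 0) (dd (1, 0) w)
  set h2 := dd (0, 1) (dd (0, 1) w)
  set h3 := dd (0, 1) (dd (1, 0) w)
  have bg : BC fun z => A z * h2 z + B z * h1 z - 2 * C z * h3 z :=
    ((hA.mul b2).add (hB.mul b1)).sub ((hC.cmul 2).mul b3)
  have bD : BC fun z => h1 z * h2 z - h3 z ^ 2 := (b1.mul b2).sub b3.sq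
  have hD : II (fun z => h1 z * h2 z - h3 z ^ 2) = 0 := by
    rw [II_sub (b1.mul b2) b3.sq, hdet, sub_self]
  have k1 : II (fun z => h1 z ^ 2 + h3 z ^ 2) ≤ Λ ^ 2 / μ ^ 4 *
      II (fun z => (A z * h2 z + B z * h1 z - 2 * C z * h3 z) ^ 2) := by
    have := II_mono (b1.sq.add b3.sq) ((bg.sq.cmul (Λ ^ 2 / μ ^ 4)).sub (bD.cmul (2 * Λ / μ)))
      (fun z => cordes_pt hμ (hAΛ z) (hQ z))
    rwa [II_sub (bg.sq.cmul (Λ ^ 2 / μ ^ 4)) (bD.cmul (2 * Λ / μ)), II_cmul, II_cmul, hD, mul_zero,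
      sub_zero] at this
  have k2 : II (fun z => h2 z ^ 2 + h3 z ^ 2) ≤ Λ ^ 2 / μ ^ 4 *
      II (fun z => (A z * h2 z + B z * h1 z - 2 * C z * h3 z) ^ 2) := by
    have := II_mono (b2.sq.add b3.sq) ((bg.sq.cmul (Λ ^ 2 / μ ^ 4)).sub (bD.cmul (2 * Λ / μ)))
      (fun z => by
        have := cordes_pt (h1 := h2 z) (h2 := h1 z) (h3 := h3 z) (A := B z) (B := A z) (C := C z)
          hμ (hBΛ z) (fun s t => by have := hQ z t s; linarith)
        calc _ ≤ _ := this
          _ = _ := by ring)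
    rwa [II_sub (bg.sq.cmul (Λ ^ 2 / μ ^ 4)) (bD.cmul (2 * Λ / μ)), II_cmul, II_cmul, hD, mul_zero,
      sub_zero] at this
  rw [II_add b1.sq b3.sq] at k1
  rw [II_add b2.sq b3.sq] at k2
  have n3 : 0 ≤ II (fun z => h3 z ^ 2) := II_nonneg fun z => sq_nonneg _
  have e : 2 * Λ ^ 2 / μ ^ 4 = Λ ^ 2 / μ ^ 4 + Λ ^ 2 / μ ^ 4 := by ring
  rw [e, add_mul]
  linarith

/-! ### The main induction -/

/-- Coefficient function `c + u - l p_x - m p_y`. -/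
lemma coef_dk {u px py : ℝ × ℝ → ℝ} (c l m : ℝ) (v z : ℝ × ℝ) (k : ℕ) :
    dk v (k + 1) (fun z => c + u z - l * px z - m * py z) z =
      dk v (k + 1) u z - l * dk v (k + 1) px z - m * dk v (k + 1) py z := by
  rw [dk_sub v (k + 1) (fun z => c + u z - l * px z) (fun z => m * py z),
    dk_sub v (k + 1) (fun z => c + u z) (fun z => l * px z),
    dk_add v (k + 1) (fun _ => c) u, dk_cmul, dk_cmul, dk_const]
  ring

lemma coef_BC {u px py : ℝ × ℝ → ℝ} (hu : BC u) (hx : BC px) (hy : BC py) (c l m : ℝ) :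
    BC (fun z => c + u z - l * px z - m * py z) :=
  (((BC.const c).add hu).sub (hx.cmul l)).sub (hy.cmul m)

lemma coef_sq {u px py : ℝ × ℝ → ℝ} (hu : BC u) (hx : BC px) (hy : BC py) (c l m : ℝ)
    (v : ℝ × ℝ) (k : ℕ) {N : ℝ} (Nx : II (fun z => dk v (k + 1) px z ^ 2) ≤ N)
    (Ny : II (fun z => dk v (k + 1) py z ^ 2) ≤ N) :
    II (fun z => dk v (k + 1) (fun z => c + u z - l * px z - m * py z) z ^ 2) ≤
      3 * II (fun z => dk v (k + 1) u z ^ 2) + 3 * (l ^ 2 + m ^ 2) * N := by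
  have bu := (hu.dk v (k + 1)).sq
  have bx := (hx.dk v (k + 1)).sq
  have by' := (hy.dk v (k + 1)).sq
  calc _ ≤ II (fun z => 3 * dk v (k + 1) u z ^ 2 + 3 * l ^ 2 * dk v (k + 1) px z ^ 2 +
        3 * m ^ 2 * dk v (k + 1) py z ^ 2) := by
        refine II_mono ((coef_BC hu hx hy c l m).dk v (k + 1)).sq
          (((bu.cmul 3).add (bx.cmul _)).add (by'.cmul _)) fun z => ?_
        rw [coef_dk]
        set a := dk v (k + 1) u z
        set b := l * dk v (k + 1) px z with hb
        set d := m * dk v (k + 1) py z with hd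
        have e1 : 3 * l ^ 2 * dk v (k + 1) px z ^ 2 = 3 * b ^ 2 := by rw [hb]; ring
        have e2 : 3 * m ^ 2 * dk v (k + 1) py z ^ 2 = 3 * d ^ 2 := by rw [hd]; ring
        rw [e1, e2]
        nlinarith [sq_nonneg (a + b), sq_nonneg (a + d), sq_nonneg (b - d)]
    _ = 3 * II (fun z => dk v (k + 1) u z ^ 2) + 3 * l ^ 2 * II (fun z => dk v (k + 1) px z ^ 2) +
        3 * m ^ 2 * II (fun z => dk v (k + 1) py z ^ 2) := by
        rw [II_add ((bu.cmul 3).add (bx.cmul _)) (by'.cmul _), II_add (bu.cmul 3) (bx.cmul _),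
          II_cmul, II_cmul, II_cmul]
    _ ≤ 3 * II (fun z => dk v (k + 1) u z ^ 2) + 3 * l ^ 2 * N + 3 * m ^ 2 * N := by gcongr
    _ = _ := by ring

/-- Sum of squared difference norms of the second derivatives. -/
noncomputable def XX (p : ℝ × ℝ → ℝ) (v : ℝ × ℝ) (k : ℕ) : ℝ :=
  II (fun z => dk v k (dd (1, 0) (dd (1, 0) p)) z ^ 2) +
    II (fun z => dk v k (dd (0, 1) (dd (0, 1) p)) z ^ 2) +
      II (fun z => dk v k (dd (0, 1) (dd (1, 0) p)) z ^ 2)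

lemma six_sq (a b c d x y : ℝ) : (a - (b + c) / 2 + d + x + y) ^ 2 ≤
    6 * (a ^ 2 + b ^ 2 + c ^ 2 + d ^ 2 + x ^ 2 + y ^ 2) := by
  nlinarith [sq_nonneg (a + b / 2), sq_nonneg (a + c / 2), sq_nonneg (a - d), sq_nonneg (a - x),
    sq_nonneg (a - y), sq_nonneg (b - c), sq_nonneg (b / 2 + d), sq_nonneg (b / 2 + x),
    sq_nonneg (b / 2 + y), sq_nonneg (c / 2 + d), sq_nonneg (c / 2 + x), sq_nonneg (c / 2 + y),
    sq_nonneg (d - x), sq_nonneg (d - y), sq_nonneg (x - y), sq_nonneg b, sq_nonneg c]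

lemma abs_mul_sq_le {α L x : ℝ} (h : |α| ≤ L) : (α * x) ^ 2 ≤ L ^ 2 * x ^ 2 := by
  rw [mul_pow, ← sq_abs α]
  gcongr

lemma main_step {a b c l11 l12 l22 m11 m12 m22 : ℝ} {p G A B C : ℝ × ℝ → ℝ}
    (hp : ContDiff ℝ 2 p) (hper : Biperiodic p)
    (hG : ContDiff ℝ (⊤ : ℕ∞) G) (hGp : Biperiodic G)
    (eA : A = fun z => a + dd (1, 0) (dd (1, 0) p) z - l11 * dd (1, 0) p z - m11 * dd (0, 1) p z)
    (eB : B = fun z => b + dd (0, 1) (dd (0, 1) p) z - l22 * dd (1, 0) p z - m22 * dd (0, 1) p z)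
    (eC : C = fun z => c + dd (0, 1) (dd (1, 0) p) z - l12 * dd (1, 0) p z - m12 * dd (0, 1) p z)
    (heq : ∀ z, A z * B z - C z * C z = G z)
    {μ Λ : ℝ} (hμ : 0 < μ) (hA : ∀ z, |A z| ≤ Λ) (hB : ∀ z, |B z| ≤ Λ) (hC : ∀ z, |C z| ≤ Λ)
    (hQ : ∀ z, ∀ s t : ℝ, μ * (s ^ 2 + t ^ 2) ≤ B z * s ^ 2 - 2 * C z * s * t + A z * t ^ 2)
    (e : ℝ × ℝ) (k : ℕ) {C0 : ℝ}
    (H0 : ∀ h : ℝ, 0 < h → h ≤ 1 →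
      II (fun z => dk (h • e) (k + 1) (dd (1, 0) p) z ^ 2) ≤ C0 * h ^ (2 * (k + 1)) ∧
      II (fun z => dk (h • e) (k + 1) (dd (0, 1) p) z ^ 2) ≤ C0 * h ^ (2 * (k + 1))) :
    ∃ C' : ℝ, ∀ h : ℝ, 0 < h → h ≤ 1 → XX p (h • e) (k + 1) ≤ C' * h ^ (2 * (k + 1)) := by
  have cx : ContDiff ℝ 1 (dd (1, 0) p) := dd_contDiff hp (by norm_num) _
  have cy : ContDiff ℝ 1 (dd (0, 1) p) := dd_contDiff hp (by norm_num) _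
  have c1 : ContDiff ℝ 1 p := hp.of_le (by norm_num)
  have bx := dd_BC c1 hper (1, 0)
  have by' := dd_BC c1 hper (0, 1)
  have b1 := dd_BC cx (dd_per hper _) (1, 0)
  have b2 := dd_BC cy (dd_per hper _) (0, 1)
  have b3 := dd_BC cx (dd_per hper _) (0, 1)
  have bA : BC A := eA ▸ coef_BC b1 bx by' a l11 m11
  have bB : BC B := eB ▸ coef_BC b2 bx by' b l22 m22
  have bC : BC C := eC ▸ coef_BC b3 bx by' c l12 m12
  have bG : BC G := ⟨hG.continuous, hGp⟩
  have hΛ : 0 ≤ Λ := (abs_nonneg _).trans (hA 0)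
  obtain ⟨CG, hCG, HG⟩ := smooth_bound e (k + 1) G hG hGp
  set K : ℝ := 2 * Λ ^ 2 / μ ^ 4 with hK
  have K0 : 0 ≤ K := by positivity
  set η : ℝ := 1 / (72 * (K + 1)) with hη
  have η0 : 0 < η := by positivity
  obtain ⟨R1, HR1⟩ := rem_bound bA bB e k η0
  obtain ⟨R2, HR2⟩ := rem_bound bB bA e k η0
  obtain ⟨R3, HR3⟩ := rem_bound bC bC e k η0
  set Lx : ℝ := Λ * |l22| + Λ * |l11| + 2 * Λ * |l12| with hLx
  set Ly : ℝ := Λ * |m22| + Λ * |m11| + 2 * Λ * |m12| with hLy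
  set q : ℝ := (l11 ^ 2 + m11 ^ 2) + (l22 ^ 2 + m22 ^ 2) + (l12 ^ 2 + m12 ^ 2) with hq
  refine ⟨2 * K * (6 * (CG ^ 2 + (6 * η * q * C0 + R1 + R2 + R3) + (Lx ^ 2 + Ly ^ 2) * C0)),
    fun h h0 h1 => ?_⟩
  obtain ⟨Nx, Ny⟩ := H0 h h0 h1
  have r1 := HR1 h h0 h1
  have r2 := HR2 h h0 h1
  have r3 := HR3 h h0 h1
  set v := h • e with hv
  set H := h ^ (2 * (k + 1)) with hH
  have sA := coef_sq b1 bx by' a l11 m11 v k Nx Ny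
  have sB := coef_sq b2 bx by' b l22 m22 v k Nx Ny
  have sC := coef_sq b3 bx by' c l12 m12 v k Nx Ny
  rw [← eA] at sA
  rw [← eB] at sB
  rw [← eC] at sC
  -- averaged coefficients
  set y := (k + 1) • v with hy
  set Am : ℝ × ℝ → ℝ := fun z => (1 / 2) * (A z + A (z + y)) with hAm
  set Bm : ℝ × ℝ → ℝ := fun z => (1 / 2) * (B z + B (z + y)) with hBm
  set Cm : ℝ × ℝ → ℝ := fun z => (1 / 2) * (C z + C (z + y)) with hCm
  have bAm : BC Am := (bA.add (bA.shift y)).cmul _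
  have bBm : BC Bm := (bB.add (bB.shift y)).cmul _
  have bCm : BC Cm := (bC.add (bC.shift y)).cmul _
  have avg : ∀ {f : ℝ × ℝ → ℝ}, (∀ z, |f z| ≤ Λ) → ∀ z, |(1 / 2) * (f z + f (z + y))| ≤ Λ := by
    intro f hf z
    have u1 := abs_le.1 (hf z)
    have u2 := abs_le.1 (hf (z + y))
    rw [abs_le]; constructor <;> linarith
  have hAm' : ∀ z, |Am z| ≤ Λ := avg hA
  have hBm' : ∀ z, |Bm z| ≤ Λ := avg hB
  have hCm' : ∀ z, |Cm z| ≤ Λ := avg hC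
  have hQm : ∀ z, ∀ s t : ℝ, μ * (s ^ 2 + t ^ 2) ≤ Bm z * s ^ 2 - 2 * Cm z * s * t + Am z * t ^ 2 := by
    intro z s t
    have u1 := hQ z s t
    have u2 := hQ (z + y) s t
    simp only [hAm, hBm, hCm]
    linarith
  -- the basic inequality
  have hw : ContDiff ℝ 2 (dk v (k + 1) p) := dk_contDiff hp v (k + 1)
  have hwp : Biperiodic (dk v (k + 1) p) := (BC.dk ⟨hp.continuous, hper⟩ v (k + 1)).per
  have cor := cordes hw hwp bAm bBm bCm hμ (fun z => (le_abs_self _).trans (hAm' z))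
    (fun z => (le_abs_self _).trans (hBm' z)) hQm
  rw [dd_dk c1, dd_dk c1, dd_dk cx, dd_dk cx, dd_dk cy] at cor
  have XXd : XX p v (k + 1) = II (fun z => dk v (k + 1) (dd (1, 0) (dd (1, 0) p)) z ^ 2) +
    II (fun z => dk v (k + 1) (dd (0, 1) (dd (0, 1) p)) z ^ 2) +
      II (fun z => dk v (k + 1) (dd (0, 1) (dd (1, 0) p)) z ^ 2) := rfl
  rw [← XXd, ← hK] at cor
  -- pointwise equation
  have pt : ∀ z, Am z * dk v (k + 1) (dd (0, 1) (dd (0, 1) p)) z +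
      Bm z * dk v (k + 1) (dd (1, 0) (dd (1, 0) p)) z -
      2 * Cm z * dk v (k + 1) (dd (0, 1) (dd (1, 0) p)) z =
      dk v (k + 1) G z - (RR (k + 1) v A B z + RR (k + 1) v B A z) / 2 + RR (k + 1) v C C z +
      (Am z * l22 + Bm z * l11 - 2 * Cm z * l12) * dk v (k + 1) (dd (1, 0) p) z +
      (Am z * m22 + Bm z * m11 - 2 * Cm z * m12) * dk v (k + 1) (dd (0, 1) p) z := by
    intro z
    have dA : dk v (k + 1) A z = dk v (k + 1) (dd (1, 0) (dd (1, 0) p)) z -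
        l11 * dk v (k + 1) (dd (1, 0) p) z - m11 * dk v (k + 1) (dd (0, 1) p) z := by rw [eA]; exact coef_dk a l11 m11 v z k
    have dB : dk v (k + 1) B z = dk v (k + 1) (dd (0, 1) (dd (0, 1) p)) z -
        l22 * dk v (k + 1) (dd (1, 0) p) z - m22 * dk v (k + 1) (dd (0, 1) p) z := by rw [eB]; exact coef_dk b l22 m22 v z k
    have dC : dk v (k + 1) C z = dk v (k + 1) (dd (0, 1) (dd (1, 0) p)) z -
        l12 * dk v (k + 1) (dd (1, 0) p) z - m12 * dk v (k + 1) (dd (0, 1) p) z := by rw [eC]; exact coef_dk c l12 m12 v z k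
    have gG : dk v (k + 1) G z = dk v (k + 1) (fun z => A z * B z) z -
        dk v (k + 1) (fun z => C z * C z) z := by
      rw [← dk_sub]; congr 1; funext z; rw [heq]
    have gc : dk v (k + 1) (fun z => B z * A z) z = dk v (k + 1) (fun z => A z * B z) z := by
      congr 1; funext z; ring
    have s1 : RR (k + 1) v A B z = dk v (k + 1) (fun z => A z * B z) z -
      A z * dk v (k + 1) B z - B (z + y) * dk v (k + 1) A z := rfl
    have s2 : RR (k + 1) v B A z = dk v (k + 1) (fun z => B z * A z) z -
      B z * dk v (k + 1) A z - A (z + y) * dk v (k + 1) B z := rfl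
    have s3 : RR (k + 1) v C C z = dk v (k + 1) (fun z => C z * C z) z -
      C z * dk v (k + 1) C z - C (z + y) * dk v (k + 1) C z := rfl
    rw [s1, s2, s3, gc, gG, dA, dB, dC]
    simp only [hAm, hBm, hCm]
    ring
  have bR1 := RR_BC bA bB (k + 1) v
  have bR2 := RR_BC bB bA (k + 1) v
  have bR3 := RR_BC bC bC (k + 1) v
  have bgx := bx.dk v (k + 1)
  have bgy := by'.dk v (k + 1)
  have coefb : ∀ l m n : ℝ, ∀ z, |Am z * l + Bm z * m - 2 * Cm z * n| ≤
      Λ * |l| + Λ * |m| + 2 * Λ * |n| := by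
    intro l m n z
    have t1 : |Am z * l| ≤ Λ * |l| := by rw [abs_mul]; gcongr; exact hAm' z
    have t2 : |Bm z * m| ≤ Λ * |m| := by rw [abs_mul]; gcongr; exact hBm' z
    have t3 : |2 * Cm z * n| ≤ 2 * Λ * |n| := by
      rw [abs_mul, abs_mul, abs_two]; gcongr; exact hCm' z
    calc _ ≤ |Am z * l + Bm z * m| + |2 * Cm z * n| := abs_sub _ _
      _ ≤ |Am z * l| + |Bm z * m| + |2 * Cm z * n| := by gcongr; exact abs_add_le _ _
      _ ≤ _ := by linarith
  have gint : II (fun z => (Am z * dk v (k + 1) (dd (0, 1) (dd (0, 1) p)) z +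
      Bm z * dk v (k + 1) (dd (1, 0) (dd (1, 0) p)) z -
      2 * Cm z * dk v (k + 1) (dd (0, 1) (dd (1, 0) p)) z) ^ 2) ≤
      6 * (CG ^ 2 * H + II (fun z => RR (k + 1) v A B z ^ 2) + II (fun z => RR (k + 1) v B A z ^ 2) +
        II (fun z => RR (k + 1) v C C z ^ 2) +
        Lx ^ 2 * II (fun z => dk v (k + 1) (dd (1, 0) p) z ^ 2) +
        Ly ^ 2 * II (fun z => dk v (k + 1) (dd (0, 1) p) z ^ 2)) := by
    have bg : BC (fun z => (Am z * dk v (k + 1) (dd (0, 1) (dd (0, 1) p)) z +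
      Bm z * dk v (k + 1) (dd (1, 0) (dd (1, 0) p)) z -
      2 * Cm z * dk v (k + 1) (dd (0, 1) (dd (1, 0) p)) z)) :=
      ((bAm.mul (b2.dk v _)).add (bBm.mul (b1.dk v _))).sub ((bCm.cmul 2).mul (b3.dk v _))
    have bs1 := (BC.const (CG ^ 2 * H)).add bR1.sq
    have bs2 := bs1.add bR2.sq
    have bs3 := bs2.add bR3.sq
    have bs4 := bs3.add (bgx.sq.cmul (Lx ^ 2))
    have bs5 := bs4.add (bgy.sq.cmul (Ly ^ 2))
    calc _ ≤ _ := II_mono bg.sq (bs5.cmul 6) (fun z => by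
          rw [pt]
          refine (six_sq _ _ _ _ _ _).trans ?_
          have g1 : dk v (k + 1) G z ^ 2 ≤ CG ^ 2 * H := by
            have := pow_le_pow_left₀ (abs_nonneg _) (HG h h0.le z) 2
            rw [sq_abs] at this
            calc _ ≤ _ := this
              _ = _ := by rw [mul_pow, ← pow_mul, mul_comm (k + 1) 2]
          have g2 := abs_mul_sq_le (x := dk v (k + 1) (dd (1, 0) p) z) (coefb l22 l11 l12 z)
          have g3 := abs_mul_sq_le (x := dk v (k + 1) (dd (0, 1) p) z) (coefb m22 m11 m12 z)
          linarith)
      _ = _ := by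
          rw [II_cmul, II_add bs4 (bgy.sq.cmul (Ly ^ 2)), II_add bs3 (bgx.sq.cmul (Lx ^ 2)),
            II_add bs2 bR3.sq, II_add bs1 bR2.sq, II_add (BC.const (CG ^ 2 * H)) bR1.sq, II_const,
            II_cmul, II_cmul]
  have nx : Lx ^ 2 * II (fun z => dk v (k + 1) (dd (1, 0) p) z ^ 2) ≤ Lx ^ 2 * (C0 * H) := by gcongr
  have ny : Ly ^ 2 * II (fun z => dk v (k + 1) (dd (0, 1) p) z ^ 2) ≤ Ly ^ 2 * (C0 * H) := by gcongr
  have XX0 : 0 ≤ XX p v (k + 1) := by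
    rw [XXd]
    have t1 := II_nonneg (f := fun z => dk v (k + 1) (dd (1, 0) (dd (1, 0) p)) z ^ 2)
      fun z => sq_nonneg _
    have t2 := II_nonneg (f := fun z => dk v (k + 1) (dd (0, 1) (dd (0, 1) p)) z ^ 2)
      fun z => sq_nonneg _
    have t3 := II_nonneg (f := fun z => dk v (k + 1) (dd (0, 1) (dd (1, 0) p)) z ^ 2)
      fun z => sq_nonneg _
    linarith
  have hsum : II (fun z => dk v (k + 1) A z ^ 2) + II (fun z => dk v (k + 1) B z ^ 2) +
      II (fun z => dk v (k + 1) C z ^ 2) ≤ 3 * XX p v (k + 1) + 3 * q * (C0 * H) := by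
    rw [XXd, hq]; linarith
  have rsum : II (fun z => RR (k + 1) v A B z ^ 2) + II (fun z => RR (k + 1) v B A z ^ 2) +
        II (fun z => RR (k + 1) v C C z ^ 2) ≤
      6 * η * XX p v (k + 1) + (6 * η * q * C0 + R1 + R2 + R3) * H := by
    have := mul_le_mul_of_nonneg_left hsum (by positivity : 0 ≤ 2 * η)
    linarith
  have tot : XX p v (k + 1) ≤ K * (6 * (6 * η * XX p v (k + 1) +
      (CG ^ 2 + (6 * η * q * C0 + R1 + R2 + R3) + (Lx ^ 2 + Ly ^ 2) * C0) * H)) := by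
    refine cor.trans (mul_le_mul_of_nonneg_left (gint.trans ?_) K0)
    linarith
  have hKη : K * (36 * η) ≤ 1 / 2 := by
    rw [hη, mul_div_assoc', mul_div_assoc', div_le_div_iff₀ (by positivity) (by norm_num)]
    linarith
  have := mul_le_mul_of_nonneg_right hKη XX0
  linarith

lemma lower {f : ℝ × ℝ → ℝ} (hf : ContDiff ℝ 1 f) (hfp : Biperiodic f) (e : ℝ × ℝ) (k : ℕ) {C h : ℝ}
    (h0 : 0 ≤ h) (H : II (fun z => dk (h • e) k (dd e f) z ^ 2) ≤ C * h ^ (2 * k)) :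
    II (fun z => dk (h • e) (k + 1) f z ^ 2) ≤ C * h ^ (2 * (k + 1)) := by
  have hB : BC f := ⟨hf.continuous, hfp⟩
  have := II_fwd_sq (dk_contDiff hf (h • e) k) (hB.dk _ k).per e h0
  rw [← dk_succ, dd_dk hf] at this
  calc _ ≤ _ := this
    _ ≤ h ^ 2 * (C * h ^ (2 * k)) := by gcongr
    _ = _ := by ring

lemma low_of_XX {p : ℝ × ℝ → ℝ} (hp : ContDiff ℝ 2 p) (hper : Biperiodic p) {e : ℝ × ℝ}
    (he : e = (1, 0) ∨ e = (0, 1)) (k : ℕ) {C h : ℝ} (h0 : 0 ≤ h)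
    (H : XX p (h • e) k ≤ C * h ^ (2 * k)) :
    II (fun z => dk (h • e) (k + 1) (dd (1, 0) p) z ^ 2) ≤ C * h ^ (2 * (k + 1)) ∧
      II (fun z => dk (h • e) (k + 1) (dd (0, 1) p) z ^ 2) ≤ C * h ^ (2 * (k + 1)) := by
  have cx : ContDiff ℝ 1 (dd (1, 0) p) := dd_contDiff hp (by norm_num) _
  have cy : ContDiff ℝ 1 (dd (0, 1) p) := dd_contDiff hp (by norm_num) _
  have t1 := II_nonneg (f := fun z => dk (h • e) k (dd (1, 0) (dd (1, 0) p)) z ^ 2)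
      fun z => sq_nonneg _
  have t2 := II_nonneg (f := fun z => dk (h • e) k (dd (0, 1) (dd (0, 1) p)) z ^ 2)
      fun z => sq_nonneg _
  have t3 := II_nonneg (f := fun z => dk (h • e) k (dd (0, 1) (dd (1, 0) p)) z ^ 2)
      fun z => sq_nonneg _
  unfold XX at H
  have hcomm := dd_comm hp (1, 0) (0, 1)
  refine ⟨lower cx (dd_per hper _) e k h0 ?_, lower cy (dd_per hper _) e k h0 ?_⟩
  · rcases he with he | he <;> subst he <;> linarith
  · rcases he with he | he <;> subst he
    · rw [hcomm]; linarith
    · linarith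

lemma form_bound {A B C m Λ : ℝ} (hA : 0 < A) (hB : 0 < B) (hAΛ : A ≤ Λ) (hBΛ : B ≤ Λ)
    (hm : 0 < m) (hd : m ≤ A * B - C * C) (s t : ℝ) :
    m / (2 * Λ) * (s ^ 2 + t ^ 2) ≤ B * s ^ 2 - 2 * C * s * t + A * t ^ 2 := by
  have hΛ : 0 < Λ := by linarith
  have key : m * (s ^ 2 + t ^ 2) ≤ (A + B) * (B * s ^ 2 - 2 * C * s * t + A * t ^ 2) := by
    have id1 : (A + B) * (B * s ^ 2 - 2 * C * s * t + A * t ^ 2) =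
        (A * B - C * C) * (s ^ 2 + t ^ 2) + ((B * s - C * t) ^ 2 + (C * s - A * t) ^ 2) := by ring
    rw [id1]
    have : m * (s ^ 2 + t ^ 2) ≤ (A * B - C * C) * (s ^ 2 + t ^ 2) := by gcongr
    have := sq_nonneg (B * s - C * t)
    have := sq_nonneg (C * s - A * t)
    linarith
  set Q := B * s ^ 2 - 2 * C * s * t + A * t ^ 2
  have Q0 : 0 ≤ Q := by
    have h1 : 0 ≤ (A + B) * Q := le_trans (by positivity) key
    exact nonneg_of_mul_nonneg_right h1 (by linarith)
  rw [div_mul_eq_mul_div, div_le_iff₀ (by positivity)]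
  nlinarith

theorem gma_regularity (a b c l11 l12 l22 m11 m12 m22 : ℝ)
    (hpd : (!![a, c; c, b]).PosDef)
    (h1 : m11 * l22 = 0)
    (h2 : l11 * l22 - l12 ^ 2 = 0)
    (h3 : m11 * m22 - m12 ^ 2 = 0)
    (h4 : l11 * m22 + l22 * m11 - 2 * l12 * m12 = 0)
    (F : ℝ × ℝ → ℝ) (hF : ContDiff ℝ (⊤ : ℕ∞) F) (hFper : Biperiodic F)
    (p : ℝ × ℝ → ℝ) (hp : ContDiff ℝ 2 p) (hper : Biperiodic p)
    (heq : ∀ z : ℝ × ℝ,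
      (a + pdx (pdx p) z - l11 * pdx p z - m11 * pdy p z) *
          (b + pdy (pdy p) z - l22 * pdx p z - m22 * pdy p z) -
        (c + pdy (pdx p) z - l12 * pdx p z - m12 * pdy p z) ^ 2 = Real.exp (F z))
    (hpos : ∀ z : ℝ × ℝ,
      (!![a + pdx (pdx p) z - l11 * pdx p z - m11 * pdy p z,
          c + pdy (pdx p) z - l12 * pdx p z - m12 * pdy p z;
          c + pdy (pdx p) z - l12 * pdx p z - m12 * pdy p z,
          b + pdy (pdy p) z - l22 * pdx p z - m22 * pdy p z]).PosDef) :
    ContDiff ℝ (⊤ : ℕ∞) p := by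
  have cx : ContDiff ℝ 1 (dd (1, 0) p) := dd_contDiff hp (by norm_num) _
  have cy : ContDiff ℝ 1 (dd (0, 1) p) := dd_contDiff hp (by norm_num) _
  have c1 : ContDiff ℝ 1 p := hp.of_le (by norm_num)
  have bp : BC p := ⟨hp.continuous, hper⟩
  have bx := dd_BC c1 hper (1, 0)
  have by' := dd_BC c1 hper (0, 1)
  have b1 := dd_BC cx (dd_per hper _) (1, 0)
  have b2 := dd_BC cy (dd_per hper _) (0, 1)
  have b3 := dd_BC cx (dd_per hper _) (0, 1)
  obtain ⟨A, eA⟩ : ∃ A : ℝ × ℝ → ℝ, A = fun z => a + dd (1, 0) (dd (1, 0) p) z -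
    l11 * dd (1, 0) p z - m11 * dd (0, 1) p z := ⟨_, rfl⟩
  obtain ⟨B, eB⟩ : ∃ B : ℝ × ℝ → ℝ, B = fun z => b + dd (0, 1) (dd (0, 1) p) z -
    l22 * dd (1, 0) p z - m22 * dd (0, 1) p z := ⟨_, rfl⟩
  obtain ⟨C, eC⟩ : ∃ C : ℝ × ℝ → ℝ, C = fun z => c + dd (0, 1) (dd (1, 0) p) z -
    l12 * dd (1, 0) p z - m12 * dd (0, 1) p z := ⟨_, rfl⟩
  have bA : BC A := eA ▸ coef_BC b1 bx by' a l11 m11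
  have bB : BC B := eB ▸ coef_BC b2 bx by' b l22 m22
  have bC : BC C := eC ▸ coef_BC b3 bx by' c l12 m12
  have heq' : ∀ z, A z * B z - C z * C z = Real.exp (F z) := by
    intro z
    rw [← heq z, ← sq, eA, eB, eC]
    rfl
  have hA0 : ∀ z, 0 < A z := by
    intro z
    have := (hpos z).diag_pos (i := 0)
    rw [eA]
    exact this
  have hB0 : ∀ z, 0 < B z := by
    intro z
    have := (hpos z).diag_pos (i := 1)
    rw [eB]
    exact this
  obtain ⟨LA, _, hLA⟩ := bA.bdd
  obtain ⟨LB, _, hLB⟩ := bB.bdd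
  obtain ⟨LC, _, hLC⟩ := bC.bdd
  obtain ⟨LF, _, hLF⟩ := BC.bdd (f := F) ⟨hF.continuous, hFper⟩
  set Λ := LA + LB + LC with hΛ
  have hAΛ : ∀ z, |A z| ≤ Λ := fun z => by have := hLA z; linarith
  have hBΛ : ∀ z, |B z| ≤ Λ := fun z => by have := hLB z; linarith
  have hCΛ : ∀ z, |C z| ≤ Λ := fun z => by have := hLC z; linarith
  have hm : ∀ z, Real.exp (-LF) ≤ A z * B z - C z * C z := by
    intro z
    rw [heq' z, Real.exp_le_exp]
    exact (abs_le.1 (hLF z)).1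
  have hμ : 0 < Real.exp (-LF) / (2 * Λ) := by
    have := Real.exp_pos (-LF)
    have : 0 < Λ := by linarith
    positivity
  have hQ : ∀ z, ∀ s t : ℝ, Real.exp (-LF) / (2 * Λ) * (s ^ 2 + t ^ 2) ≤
      B z * s ^ 2 - 2 * C z * s * t + A z * t ^ 2 := fun z s t =>
    form_bound (hA0 z) (hB0 z) ((le_abs_self _).trans (hAΛ z)) ((le_abs_self _).trans (hBΛ z))
      (Real.exp_pos _) (hm z) s t
  have hG : ContDiff ℝ (⊤ : ℕ∞) fun z => Real.exp (F z) := hF.exp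
  have hGp : Biperiodic fun z => Real.exp (F z) :=
    (BC.comp (f := F) ⟨hF.continuous, hFper⟩ Real.continuous_exp).per
  have T : ∀ e : ℝ × ℝ, e = (1, 0) ∨ e = (0, 1) → ∀ k : ℕ, ∃ C' : ℝ, ∀ h : ℝ, 0 < h → h ≤ 1 →
      XX p (h • e) k ≤ C' * h ^ (2 * k) := by
    intro e he k
    induction k with
    | zero =>
      refine ⟨XX p 0 0, fun h _ _ => ?_⟩
      simp [XX, dk_zero]
    | succ k ih =>
      obtain ⟨C0, H0⟩ := ih
      exact main_step hp hper hG hGp eA eB eC heq' hμ hAΛ hBΛ hCΛ hQ e k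
        (fun h h0 h1 => low_of_XX hp hper he k h0.le (H0 h h0 h1))
  refine smooth_of_decay bp ?_
  intro k hk e he
  obtain ⟨m, rfl⟩ : ∃ m, k = m + 2 := ⟨k - 2, by omega⟩
  obtain ⟨C', H'⟩ := T e he m
  refine ⟨C', fun h h0 h1 => ?_⟩
  have := low_of_XX hp hper he m h0.le (H' h h0 h1)
  refine lower c1 hper e (m + 1) h0.le ?_
  rcases he with he | he <;> subst he
  · exact this.1
  · exact this.2
end

section
/- Let a, b, c and (l_ij), (m_ij) and F be as in the generalized Monge–Ampère setup. There exists a constant C > 0, depending only on F, a, b, c, (l_ij), (m_ij), such that for every t ∈ [0,1] and every twice continuously differentiable biperiodic function p satisfying the deformed equation (GMA_t) and the deformed ellipticity condition (E_t), all second partial derivatives of p are bounded: |p_xx| ≤ C, |p_xy| ≤ C and |p_yy| ≤ C everywhere on ℝ². -/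
open MeasureTheory

lemma gma_grad1d (f f' f'' : ℝ → ℝ) (k κ K : ℝ) (hf : ∀ s, HasDerivAt f (f' s) s)
    (hf' : ∀ s, HasDerivAt f' (f'' s) s) (hper : ∀ s, f (s + 1) = f s) (hk : |k| ≤ κ)
    (hK : 0 ≤ K) (hlow : ∀ s, -K ≤ f'' s - k * f' s) (x : ℝ) : |f' x| ≤ K * Real.exp κ := by
  have hc : Continuous f := continuous_iff_continuousAt.2 fun s => (hf s).continuousAt
  obtain ⟨x0, hx0, hz0⟩ := exists_hasDerivAt_eq_zero (f := f) (f' := f') (a := x - 1) (b := x)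
    (by linarith) hc.continuousOn (by have := hper (x - 1); simp at this; exact this.symm)
    (fun s _ => hf s)
  obtain ⟨x1, hx1, hz1⟩ := exists_hasDerivAt_eq_zero (f := f) (f' := f') (a := x) (b := x + 1)
    (by linarith) hc.continuousOn (hper x).symm (fun s _ => hf s)
  set g : ℝ → ℝ := fun s => Real.exp (-k * (s - x)) * f' s with hg
  have hgd : ∀ s, HasDerivAt g (Real.exp (-k * (s - x)) * (f'' s - k * f' s)) s := by
    intro s
    have h1 : HasDerivAt (fun s : ℝ => -k * (s - x)) (-k) s := by
      simpa using ((hasDerivAt_id s).sub_const x).const_mul (-k)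
    refine (h1.exp.mul (hf' s)).congr_deriv ?_
    ring
  have hbd : ∀ s, |s - x| ≤ 1 → -(K * Real.exp κ) ≤ Real.exp (-k * (s - x)) * (f'' s - k * f' s) := by
    intro s hs
    have h1 : -k * (s - x) ≤ κ := by
      calc -k * (s - x) ≤ |-k * (s - x)| := le_abs_self _
        _ = |k| * |s - x| := by rw [abs_mul, abs_neg]
        _ ≤ κ * 1 := by
          apply mul_le_mul hk hs (abs_nonneg _) (le_trans (abs_nonneg _) hk)
        _ = κ := mul_one _
    have h2 := Real.exp_le_exp.2 h1
    have h3 := Real.exp_pos (-k * (s - x))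
    have h4 := hlow s
    nlinarith
  have hgc : Continuous g := continuous_iff_continuousAt.2 fun s => (hgd s).continuousAt
  have mv : ∀ u v : ℝ, u < v → x - 1 ≤ u → v ≤ x + 1 → g u - K * Real.exp κ * (v - u) ≤ g v := by
    intro u v huv hu hv
    obtain ⟨ξ, hξ, he⟩ := exists_hasDerivAt_eq_slope g _ huv hgc.continuousOn (fun s _ => hgd s)
    have := hbd ξ (abs_le.2 ⟨by linarith [hξ.1], by linarith [hξ.2]⟩)
    rw [he, le_div_iff₀ (by linarith)] at this
    linarith
  have hgx : g x = f' x := by simp [hg]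
  have hg0 : g x0 = 0 := by simp [hg, hz0]
  have hg1 : g x1 = 0 := by simp [hg, hz1]
  have hKe : 0 ≤ K * Real.exp κ := by positivity
  have A := mv x0 x hx0.2 hx0.1.le (by linarith)
  have B := mv x x1 hx1.1 (by linarith) hx1.2.le
  rw [hg0, hgx] at A
  rw [hg1, hgx] at B
  have h5 := hx0.1
  have h6 := hx1.2
  rw [abs_le]
  constructor <;> nlinarith

lemma gma_second_diff (f f' f'' : ℝ → ℝ) (B h : ℝ) (hf : ∀ s, HasDerivAt f (f' s) s)
    (hf' : ∀ s, HasDerivAt f' (f'' s) s) (hh : 0 < h) (hB : ∀ s, |s| ≤ h → f'' s ≤ B) :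
    f h + f (-h) - 2 * f 0 ≤ B * h ^ 2 := by
  have hc' : Continuous f' := continuous_iff_continuousAt.2 fun s => (hf' s).continuousAt
  have key : ∀ s, 0 < s → s ≤ h → f' s - f' (-s) ≤ B * (2 * s) := by
    intro s hs hsh
    obtain ⟨ξ, hξ, he⟩ := exists_hasDerivAt_eq_slope f' f'' (a := -s) (b := s) (by linarith)
      hc'.continuousOn (fun s _ => hf' s)
    have := hB ξ (abs_le.2 ⟨by linarith [hξ.1], by linarith [hξ.2]⟩)
    rw [he, div_le_iff₀ (by linarith)] at this
    linarith
  set g : ℝ → ℝ := fun s => f s + f (-s) - B * s ^ 2 with hg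
  have hgd : ∀ s, HasDerivAt g (f' s - f' (-s) - B * (2 * s)) s := by
    intro s
    have h1 : HasDerivAt (fun s => f (-s)) (-(f' (-s))) s := by
      have := (hf (-s)).comp s (hasDerivAt_neg s)
      rw [mul_neg_one] at this
      exact this
    have h2 : HasDerivAt (fun s : ℝ => B * s ^ 2) (B * (2 * s)) s := by
      simpa using (hasDerivAt_pow 2 s).const_mul B
    refine (((hf s).add h1).sub h2).congr_deriv ?_
    ring
  have hgc : Continuous g := continuous_iff_continuousAt.2 fun s => (hgd s).continuousAt
  obtain ⟨ξ, hξ, he⟩ := exists_hasDerivAt_eq_slope g _ hh hgc.continuousOn (fun s _ => hgd s)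
  have := key ξ hξ.1 hξ.2.le
  have h3 : (g h - g 0) / (h - 0) ≤ 0 := by rw [← he]; linarith
  rw [div_le_iff₀ (by linarith)] at h3
  simp [hg] at h3
  linarith

lemma gma_max_test (f f' : ℝ → ℝ) (f2 : ℝ) (hf : ∀ s, HasDerivAt f (f' s) s)
    (hf' : HasDerivAt f' f2 0) (hmax : ∀ s, f s ≤ f 0) : f' 0 = 0 ∧ f2 ≤ 0 := by
  have hM : IsLocalMax f 0 := Filter.Eventually.of_forall hmax
  have h0 : f' 0 = 0 := hM.hasDerivAt_eq_zero (hf 0)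
  refine ⟨h0, ?_⟩
  by_contra! hpos
  have hd : deriv f = f' := funext fun s => (hf s).deriv
  have hmin : IsLocalMin f 0 := by
    apply isLocalMin_of_deriv_deriv_pos
    · rw [hd, hf'.deriv]; exact hpos
    · rw [hd, h0]
    · exact (hf 0).continuousAt
  have hconst : f =ᶠ[nhds 0] fun _ => f 0 := by
    filter_upwards [hmin] with s hs
    exact le_antisymm (hmax s) hs
  have h1 : f' =ᶠ[nhds 0] fun _ => 0 := by
    have := hconst.deriv
    rw [hd] at this
    simpa using this
  have h2 := h1.deriv_eq
  rw [hf'.deriv] at h2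
  simp at h2
  linarith

lemma gma_line (p : ℝ × ℝ → ℝ) (hp : Differentiable ℝ p) (w v : ℝ × ℝ) (s : ℝ) :
    HasDerivAt (fun s : ℝ => p (w + s • v)) (fderiv ℝ p (w + s • v) v) s := by
  have h1 : HasDerivAt (fun s : ℝ => w + s • v) v s := by
    simpa using ((hasDerivAt_id s).smul_const v).const_add w
  exact (hp _).hasFDerivAt.comp_hasDerivAt s h1

lemma gma_c1 (p : ℝ × ℝ → ℝ) (hp : ContDiff ℝ 2 p) (v : ℝ × ℝ) :
    ContDiff ℝ 1 (fun z => fderiv ℝ p z v) :=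
  (hp.fderiv_right (m := 1) (by norm_num)).clm_apply contDiff_const

lemma gma_c0 (p : ℝ × ℝ → ℝ) (hp : ContDiff ℝ 2 p) (v w : ℝ × ℝ) :
    Continuous (fun z => fderiv ℝ (fun z => fderiv ℝ p z v) z w) :=
  ((gma_c1 p hp v).continuous_fderiv (by norm_num)).clm_apply continuous_const

lemma gma_fd1 (p : ℝ × ℝ → ℝ) (α β : ℝ) (z : ℝ × ℝ) :
    fderiv ℝ p z (α, β) = α * pdx p z + β * pdy p z := by
  have : ((α, β) : ℝ × ℝ) = α • ((1, 0) : ℝ × ℝ) + β • ((0, 1) : ℝ × ℝ) := by simp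
  rw [this, map_add, map_smul, map_smul]; rfl

lemma gma_symm (p : ℝ × ℝ → ℝ) (hp : ContDiff ℝ 2 p) (z : ℝ × ℝ) :
    pdx (pdy p) z = pdy (pdx p) z := by
  have hd : DifferentiableAt ℝ (fderiv ℝ p) z :=
    ((hp.fderiv_right (m := 1) (by norm_num)).differentiable (by norm_num)) z
  have h : ∀ v w, fderiv ℝ (fun z => fderiv ℝ p z v) z w = fderiv ℝ (fderiv ℝ p) z w v := by
    intro v w
    rw [fderiv_clm_apply hd (differentiableAt_const v)]
    simp
  have hs : IsSymmSndFDerivAt ℝ p z := hp.contDiffAt.isSymmSndFDerivAt (by simp)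
  change fderiv ℝ (fun z => fderiv ℝ p z (0,1)) z (1,0) = fderiv ℝ (fun z => fderiv ℝ p z (1,0)) z (0,1)
  rw [h, h]
  exact hs _ _

lemma gma_fd2 (p : ℝ × ℝ → ℝ) (hp : ContDiff ℝ 2 p) (α β : ℝ) (z : ℝ × ℝ) :
    fderiv ℝ (fun z => fderiv ℝ p z (α, β)) z (α, β) =
      α ^ 2 * pdx (pdx p) z + 2 * α * β * pdy (pdx p) z + β ^ 2 * pdy (pdy p) z := by
  have h1 : DifferentiableAt ℝ (pdx p) z := (gma_c1 p hp (1, 0)).differentiable (by norm_num) z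
  have h2 : DifferentiableAt ℝ (pdy p) z := (gma_c1 p hp (0, 1)).differentiable (by norm_num) z
  have h3 : HasFDerivAt (fun z => fderiv ℝ p z (α, β))
      (α • fderiv ℝ (pdx p) z + β • fderiv ℝ (pdy p) z) z := by
    simp only [gma_fd1]
    exact (h1.hasFDerivAt.const_mul α).add (h2.hasFDerivAt.const_mul β)
  rw [h3.fderiv]
  have hs := gma_symm p hp z
  simp only [add_apply, smul_apply, smul_eq_mul, gma_fd1, hs]
  ring

lemma gma_mixed (x y z x' y' z' r : ℝ) (hx : 0 < x) (hx' : 0 < x')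
    (hz : 0 ≤ z) (hz' : 0 ≤ z') (h : 0 ≤ x * z - y ^ 2) (h' : 0 ≤ x' * z' - y' ^ 2)
    (hr : r ^ 2 ≤ (x * z - y ^ 2) * (x' * z' - y' ^ 2)) :
    2 * r ≤ x * z' + z * x' - 2 * y * y' := by
  have hxx : 0 < x * x' := mul_pos hx hx'
  set d := x * z - y ^ 2 with hd
  set d' := x' * z' - y' ^ 2 with hd'
  have e : x * x' * (x * z' + z * x' - 2 * y * y') = x ^ 2 * d' + x' ^ 2 * d + (x * y' - x' * y) ^ 2 := by
    rw [hd, hd']; ring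
  have hS : 0 ≤ x ^ 2 * d' + x' ^ 2 * d := by positivity
  have h1 : (2 * (x * x' * r)) ^ 2 ≤ (x ^ 2 * d' + x' ^ 2 * d) ^ 2 := by
    have : (x * x') ^ 2 * r ^ 2 ≤ (x * x') ^ 2 * (d * d') := by gcongr
    nlinarith [sq_nonneg (x ^ 2 * d' - x' ^ 2 * d)]
  have h2 := abs_le_of_sq_le_sq' h1 hS |>.2
  have h3 : x * x' * (2 * r) ≤ x * x' * (x * z' + z * x' - 2 * y * y') := by
    rw [e]; nlinarith [sq_nonneg (x * y' - x' * y)]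
  exact le_of_mul_le_mul_left h3 hxx

lemma gma_per (p : ℝ × ℝ → ℝ) (hper : Biperiodic p) (x y : ℝ) :
    p (x, y) = p (Int.fract x, Int.fract y) := by
  have h1 : Function.Periodic (fun x => p (x, y)) 1 := fun x => (hper x y).1
  have h2 : Function.Periodic (fun y => p (Int.fract x, y)) 1 := fun y => (hper _ y).2
  have e1 := h1.sub_int_mul_eq ⌊x⌋ (x := x)
  have e2 := h2.sub_int_mul_eq ⌊y⌋ (x := y)
  simp only [mul_one] at e1 e2
  rw [← e1]
  change p (Int.fract x, y) = _
  rw [← e2]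
  rfl

lemma gma_posdef {x y z : ℝ} (h : (!![x, y; y, z]).PosDef) : 0 < x ∧ 0 < z ∧ 0 < x * z - y ^ 2 := by
  have h1 := h.diag_pos (i := 0)
  have h2 := h.diag_pos (i := 1)
  have h3 := h.det_pos
  simp [Matrix.det_fin_two] at h1 h2 h3
  exact ⟨h1, h2, by nlinarith⟩

lemma gma_osc (p : ℝ × ℝ → ℝ) (hp : Differentiable ℝ p) (hper : Biperiodic p) (P : ℝ)
    (hP : ∀ z, |pdx p z| ≤ P ∧ |pdy p z| ≤ P) (z w : ℝ × ℝ) : p z ≤ p w + 2 * P := by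
  obtain ⟨x, y⟩ := z
  obtain ⟨x', y'⟩ := w
  rw [gma_per p hper x y, gma_per p hper x' y']
  have b1 := Int.fract_nonneg x
  have b2 := Int.fract_lt_one x
  have b3 := Int.fract_nonneg y
  have b4 := Int.fract_lt_one y
  have b5 := Int.fract_nonneg x'
  have b6 := Int.fract_lt_one x'
  have b7 := Int.fract_nonneg y'
  have b8 := Int.fract_lt_one y'
  generalize Int.fract x = X at *
  generalize Int.fract y = Y at *
  generalize Int.fract x' = X' at *
  generalize Int.fract y' = Y' at *
  set v : ℝ × ℝ := (X - X', Y - Y') with hv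
  have hl := gma_line p hp (X', Y') v
  have hc : Continuous (fun s : ℝ => p ((X', Y') + s • v)) :=
    continuous_iff_continuousAt.2 fun s => (hl s).continuousAt
  obtain ⟨ξ, hξ, he⟩ := exists_hasDerivAt_eq_slope _ _ (zero_lt_one) hc.continuousOn
    (fun s _ => hl s)
  rw [hv, gma_fd1] at he
  simp at he
  obtain ⟨q1, q2⟩ := hP ((X', Y') + ξ • v)
  have r1 : (X - X') * pdx p ((X', Y') + ξ • v) ≤ P := by
    calc _ ≤ |(X - X') * pdx p ((X', Y') + ξ • v)| := le_abs_self _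
      _ = |X - X'| * |pdx p ((X', Y') + ξ • v)| := abs_mul _ _
      _ ≤ 1 * P := by
        apply mul_le_mul _ q1 (abs_nonneg _) zero_le_one
        rw [abs_le]; constructor <;> linarith
      _ = P := one_mul _
  have r2 : (Y - Y') * pdy p ((X', Y') + ξ • v) ≤ P := by
    calc _ ≤ |(Y - Y') * pdy p ((X', Y') + ξ • v)| := le_abs_self _
      _ = |Y - Y'| * |pdy p ((X', Y') + ξ • v)| := abs_mul _ _
      _ ≤ 1 * P := by
        apply mul_le_mul _ q2 (abs_nonneg _) zero_le_one
        rw [abs_le]; constructor <;> linarith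
      _ = P := one_mul _
  simp only [hv, Prod.smul_mk, smul_eq_mul, Prod.mk_add_mk] at r1 r2
  linarith

lemma gma_max (Q : ℝ × ℝ → ℝ) (hQ : Continuous Q) (hper : Biperiodic Q) :
    ∃ z0, ‖z0‖ ≤ 1 ∧ ∀ z, Q z ≤ Q z0 := by
  obtain ⟨z0, hz0, hm⟩ := (isCompact_closedBall (0 : ℝ × ℝ) 1).exists_isMaxOn
    ⟨0, by simp⟩ hQ.continuousOn
  refine ⟨z0, by simpa using hz0, ?_⟩
  rintro ⟨x, y⟩
  rw [gma_per Q hper]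
  apply hm
  simp only [mem_closedBall_zero_iff, Prod.norm_mk, Real.norm_eq_abs, sup_le_iff, Int.abs_fract]
  exact ⟨(Int.fract_lt_one x).le, (Int.fract_lt_one y).le⟩

lemma gma_sd (p : ℝ × ℝ → ℝ) (hp : ContDiff ℝ 2 p) (e w : ℝ × ℝ) (B h : ℝ) (hh : 0 < h)
    (hB : ∀ s : ℝ, |s| ≤ h → fderiv ℝ (fun z => fderiv ℝ p z e) (w + s • e) e ≤ B) :
    p (w + h • e) + p (w - h • e) - 2 * p w ≤ B * h ^ 2 := by
  have := gma_second_diff (fun s : ℝ => p (w + s • e)) (fun s : ℝ => fderiv ℝ p (w + s • e) e)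
    (fun s : ℝ => fderiv ℝ (fun z => fderiv ℝ p z e) (w + s • e) e) B h
    (gma_line p (hp.differentiable (by norm_num)) w e)
    (gma_line _ ((gma_c1 p hp e).differentiable (by norm_num)) w e) hh hB
  simpa [sub_eq_add_neg] using this

lemma gma_sd' (p : ℝ × ℝ → ℝ) (hp : ContDiff ℝ 2 p) (e w : ℝ × ℝ) (B h : ℝ) (hh : 0 < h)
    (hB : ∀ s : ℝ, |s| ≤ h → B ≤ fderiv ℝ (fun z => fderiv ℝ p z e) (w + s • e) e) :
    B * h ^ 2 ≤ p (w + h • e) + p (w - h • e) - 2 * p w := by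
  have := gma_second_diff (fun s : ℝ => - p (w + s • e)) (fun s : ℝ => - fderiv ℝ p (w + s • e) e)
    (fun s : ℝ => - fderiv ℝ (fun z => fderiv ℝ p z e) (w + s • e) e) (-B) h
    (fun s => (gma_line p (hp.differentiable (by norm_num)) w e s).neg)
    (fun s => (gma_line _ ((gma_c1 p hp e).differentiable (by norm_num)) w e s).neg) hh
    (fun s hs => neg_le_neg (hB s hs))
  simp only [zero_smul, add_zero, neg_smul, ← sub_eq_add_neg] at this
  linarith

set_option maxHeartbeats 2000000 in
lemma gma_core (a b c l11 l12 l22 m11 m12 m22 : ℝ) (hd : 0 ≤ a * b - c ^ 2)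
    (F : ℝ × ℝ → ℝ) (hF : ContDiff ℝ 2 F) (e : ℝ × ℝ) (he : ‖e‖ ≤ 1) (CF E P : ℝ) (hCF : 0 ≤ CF)
    (hCFb : ∀ z, ‖z‖ ≤ 2 → |fderiv ℝ (fun z => fderiv ℝ F z e) z e| ≤ CF)
    (hE : ∀ z, ‖z‖ ≤ 2 → Real.exp (F z) ≤ E)
    (t : ℝ) (ht : t ∈ Set.Icc (0:ℝ) 1) (p : ℝ × ℝ → ℝ) (hp : ContDiff ℝ 2 p)
    (hper : Biperiodic p) (hP : ∀ z, |pdx p z| ≤ P ∧ |pdy p z| ≤ P)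
    (M11 M12 M22 : ℝ × ℝ → ℝ)
    (hM11 : ∀ z, M11 z = a + pdx (pdx p) z - t * l11 * pdx p z - t * m11 * pdy p z)
    (hM22 : ∀ z, M22 z = b + pdy (pdy p) z - t * l22 * pdx p z - t * m22 * pdy p z)
    (hM12 : ∀ z, M12 z = c + pdy (pdx p) z - t * l12 * pdx p z - t * m12 * pdy p z)
    (heq : ∀ z, M11 z * M22 z - M12 z ^ 2 = t * Real.exp (F z) + (1 - t) * (a * b - c ^ 2))
    (hpos : ∀ z, 0 < M11 z ∧ 0 < M22 z ∧ 0 < M11 z * M22 z - M12 z ^ 2) (z : ℝ × ℝ) :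
    ∃ z0, b * M11 z0 + a * M22 z0 - 2 * c * M12 z0 ≤ 2 * (E + (a * b - c ^ 2)) + E * CF ∧
      fderiv ℝ (fun z => fderiv ℝ p z e) z e ≤
        fderiv ℝ (fun z => fderiv ℝ p z e) z0 e + 2 + 2 * P := by
  obtain ⟨ht0, ht1⟩ := ht
  set pe : ℝ × ℝ → ℝ := fun z => fderiv ℝ (fun z => fderiv ℝ p z e) z e with hpe
  have hpec : Continuous pe := gma_c0 p hp e e
  have huc := (isCompact_closedBall (0 : ℝ × ℝ) (‖z‖ + 3)).uniformContinuousOn_of_continuous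
    hpec.continuousOn
  rw [Metric.uniformContinuousOn_iff] at huc
  obtain ⟨δ, hδ, huc⟩ := huc 1 one_pos
  obtain ⟨h, hh, hh1, hhδ⟩ : ∃ h : ℝ, 0 < h ∧ h ≤ 1 ∧ h < δ :=
    ⟨min 1 (δ / 2), by positivity, min_le_left _ _, lt_of_le_of_lt (min_le_right _ _) (by linarith)⟩
  have hse : ∀ s : ℝ, |s| ≤ h → ‖s • e‖ ≤ h := by
    intro s hs
    rw [norm_smul, Real.norm_eq_abs]
    nlinarith [abs_nonneg s, norm_nonneg e]
  have hclose : ∀ w : ℝ × ℝ, ‖w‖ ≤ ‖z‖ + 1 → ∀ s : ℝ, |s| ≤ h → |pe (w + s • e) - pe w| < 1 := by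
    intro w hw s hs
    have h1 := hse s hs
    have := huc (w + s • e) (by
      rw [mem_closedBall_zero_iff]
      linarith [norm_add_le w (s • e)]) w (by rw [mem_closedBall_zero_iff]; linarith)
      (by rw [dist_eq_norm]; simp only [add_sub_cancel_left]; linarith)
    simpa [Real.dist_eq] using this
  set Q : ℝ × ℝ → ℝ := fun w => p (w + h • e) + p (w - h • e) - (2 + h ^ 2) * p w with hQ
  have hpc := hp.continuous
  have hQc : Continuous Q := by simp only [hQ]; fun_prop
  have hQper : Biperiodic Q := by
    intro x y
    obtain ⟨e1, e2⟩ := e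
    simp only [hQ, Prod.smul_mk, smul_eq_mul, Prod.mk_add_mk, Prod.mk_sub_mk]
    constructor
    · rw [show x + 1 + h * e1 = x + h * e1 + 1 by ring, show x + 1 - h * e1 = x - h * e1 + 1 by ring,
        (hper _ _).1, (hper _ _).1, (hper _ _).1]
    · rw [show y + 1 + h * e2 = y + h * e2 + 1 by ring, show y + 1 - h * e2 = y - h * e2 + 1 by ring,
        (hper _ _).2, (hper _ _).2, (hper _ _).2]
  obtain ⟨z0, hz0, hmax⟩ := gma_max Q hQc hQper
  refine ⟨z0, ?_, ?_⟩
  · set w1 := z0 + h • e with hw1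
    set w2 := z0 - h • e with hw2
    have hpd : Differentiable ℝ p := hp.differentiable (by norm_num)
    have test : ∀ v : ℝ × ℝ, (fderiv ℝ p w1 v + fderiv ℝ p w2 v - (2 + h ^ 2) * fderiv ℝ p z0 v = 0) ∧
        (fderiv ℝ (fun z => fderiv ℝ p z v) w1 v + fderiv ℝ (fun z => fderiv ℝ p z v) w2 v
          - (2 + h ^ 2) * fderiv ℝ (fun z => fderiv ℝ p z v) z0 v ≤ 0) := by
      intro v
      have hpv : Differentiable ℝ (fun z => fderiv ℝ p z v) :=
        (gma_c1 p hp v).differentiable (by norm_num)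
      have := gma_max_test
        (fun s : ℝ => p (w1 + s • v) + p (w2 + s • v) - (2 + h ^ 2) * p (z0 + s • v))
        (fun s : ℝ => fderiv ℝ p (w1 + s • v) v + fderiv ℝ p (w2 + s • v) v
          - (2 + h ^ 2) * fderiv ℝ p (z0 + s • v) v) _
        (fun s => ((gma_line p hpd w1 v s).add (gma_line p hpd w2 v s)).sub
          ((gma_line p hpd z0 v s).const_mul _))
        (((gma_line _ hpv w1 v 0).add (gma_line _ hpv w2 v 0)).sub
          ((gma_line _ hpv z0 v 0).const_mul _))
        (by
          intro s
          have := hmax (z0 + s • v)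
          simp only [hQ] at this
          simp only [zero_smul, add_zero, hw1, hw2]
          rw [show z0 + h • e + s • v = z0 + s • v + h • e by abel,
            show z0 - h • e + s • v = z0 + s • v - h • e by abel]
          exact this)
      simpa using this
    have gx := (test (1, 0)).1
    have gy := (test (0, 1)).1
    change pdx p w1 + pdx p w2 - (2 + h ^ 2) * pdx p z0 = 0 at gx
    change pdy p w1 + pdy p w2 - (2 + h ^ 2) * pdy p z0 = 0 at gy
    have s1 := (test (0, 1)).2
    have s2 := (test (M22 z0, - M12 z0)).2
    simp only [gma_fd2 p hp] at s1 s2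
    obtain ⟨k1, k2, k3⟩ := hpos z0
    have mix : ∀ w, 2 * (t * (Real.exp (F z0 / 2) * Real.exp (F w / 2)) + (1 - t) * (a * b - c ^ 2)) ≤
        M11 z0 * M22 w + M22 z0 * M11 w - 2 * M12 z0 * M12 w := by
      intro w
      obtain ⟨j1, j2, j3⟩ := hpos w
      apply gma_mixed _ _ _ _ _ _ _ k1 j1 k2.le j2.le k3.le j3.le
      rw [heq, heq]
      have e1 : Real.exp (F z0) = Real.exp (F z0 / 2) ^ 2 := by
        rw [← Real.exp_nat_mul]; congr 1; push_cast; ring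
      have e2 : Real.exp (F w) = Real.exp (F w / 2) ^ 2 := by
        rw [← Real.exp_nat_mul]; congr 1; push_cast; ring
      rw [e1, e2]
      have : 0 ≤ t * ((1 - t) * (a * b - c ^ 2)) :=
        mul_nonneg ht0 (mul_nonneg (by linarith) hd)
      nlinarith [mul_nonneg this (sq_nonneg (Real.exp (F z0 / 2) - Real.exp (F w / 2)))]
    have m1 := mix w1
    have m2 := mix w2
    have hexp : ∀ w, Real.exp (F z0) * (1 + (F w - F z0) / 2) ≤
        Real.exp (F z0 / 2) * Real.exp (F w / 2) := by
      intro w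
      rw [← Real.exp_add, show F z0 / 2 + F w / 2 = F z0 + (F w - F z0) / 2 by ring, Real.exp_add]
      have := Real.add_one_le_exp ((F w - F z0) / 2)
      have h2 := Real.exp_pos (F z0)
      nlinarith
    have x1 := mul_le_mul_of_nonneg_left (hexp w1) ht0
    have x2 := mul_le_mul_of_nonneg_left (hexp w2) ht0
    have hFs : -CF * h ^ 2 ≤ F w1 + F w2 - 2 * F z0 := by
      apply gma_sd' F hF e z0 _ h hh
      intro s hs
      have := hCFb (z0 + s • e) (by linarith [norm_add_le z0 (s • e), hse s hs])
      exact (abs_le.1 this).1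
    have hEz := hE z0 (by linarith)
    have hexpos := Real.exp_pos (F z0)
    have hte : t * Real.exp (F z0) ≤ E := by nlinarith
    have hte0 : 0 ≤ t * Real.exp (F z0) := by positivity
    have y1 := mul_le_mul_of_nonneg_left hFs hte0
    have y2 : t * Real.exp (F z0) * (CF * h ^ 2) ≤ E * (CF * h ^ 2) := by gcongr
    have heq0 := heq z0
    set S11 := pdx (pdx p) w1 + pdx (pdx p) w2 - (2 + h ^ 2) * pdx (pdx p) z0 with hS11
    set S12 := pdy (pdx p) w1 + pdy (pdx p) w2 - (2 + h ^ 2) * pdy (pdx p) z0 with hS12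
    set S22 := pdy (pdy p) w1 + pdy (pdy p) w2 - (2 + h ^ 2) * pdy (pdy p) z0 with hS22
    have t1 : S22 ≤ 0 := by rw [hS22]; linarith
    have t2 : M22 z0 ^ 2 * S11 - 2 * M22 z0 * M12 z0 * S12 + M12 z0 ^ 2 * S22 ≤ 0 := by
      rw [hS11, hS12, hS22]; linarith
    have t3 : M22 z0 * S11 - 2 * M12 z0 * S12 + M11 z0 * S22 ≤ 0 := by
      have : M22 z0 * (M22 z0 * S11 - 2 * M12 z0 * S12 + M11 z0 * S22) ≤ 0 := by
        nlinarith [mul_nonneg k3.le (neg_nonneg.2 t1)]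
      by_contra! hc
      nlinarith [mul_pos k2 hc]
    have r11 : M11 w1 + M11 w2 - (2 + h ^ 2) * M11 z0 = S11 - h ^ 2 * a := by
      rw [hM11, hM11, hM11, hS11]
      linear_combination (- t * l11) * gx + (- t * m11) * gy
    have r12 : M12 w1 + M12 w2 - (2 + h ^ 2) * M12 z0 = S12 - h ^ 2 * c := by
      rw [hM12, hM12, hM12, hS12]
      linear_combination (- t * l12) * gx + (- t * m12) * gy
    have r22 : M22 w1 + M22 w2 - (2 + h ^ 2) * M22 z0 = S22 - h ^ 2 * b := by
      rw [hM22, hM22, hM22, hS22]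
      linear_combination (- t * l22) * gx + (- t * m22) * gy
    have tot : (M11 z0 * M22 w1 + M22 z0 * M11 w1 - 2 * M12 z0 * M12 w1) +
        (M11 z0 * M22 w2 + M22 z0 * M11 w2 - 2 * M12 z0 * M12 w2) -
        (2 + h ^ 2) * (2 * (t * Real.exp (F z0) + (1 - t) * (a * b - c ^ 2))) =
        (M22 z0 * S11 - 2 * M12 z0 * S12 + M11 z0 * S22) -
          h ^ 2 * (b * M11 z0 + a * M22 z0 - 2 * c * M12 z0) := by
      linear_combination M22 z0 * r11 - 2 * M12 z0 * r12 + M11 z0 * r22 + 2 * (2 + h ^ 2) * heq0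
    have hG : t * Real.exp (F z0) + (1 - t) * (a * b - c ^ 2) ≤ E + (a * b - c ^ 2) := by
      nlinarith [mul_nonneg ht0 hd]
    have hGh := mul_le_mul_of_nonneg_left hG (sq_nonneg h)
    have fin : h ^ 2 * (b * M11 z0 + a * M22 z0 - 2 * c * M12 z0) ≤
        h ^ 2 * (2 * (E + (a * b - c ^ 2)) + E * CF) := by
      linarith
    exact le_of_mul_le_mul_left fin (by positivity)
  · have A : (pe z - 1) * h ^ 2 ≤ p (z + h • e) + p (z - h • e) - 2 * p z := by
      apply gma_sd' p hp e z _ h hh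
      intro s hs
      have := (abs_lt.1 (hclose z (by linarith) s hs)).1
      linarith
    have B : p (z0 + h • e) + p (z0 - h • e) - 2 * p z0 ≤ (pe z0 + 1) * h ^ 2 := by
      apply gma_sd p hp e z0 _ h hh
      intro s hs
      have := (abs_lt.1 (hclose z0 (by linarith [norm_nonneg z]) s hs)).2
      change pe _ ≤ _
      linarith
    have C := hmax z
    simp only [hQ] at C
    have D := gma_osc p (hp.differentiable (by norm_num)) hper P hP z z0
    have D' := mul_le_mul_of_nonneg_left D (sq_nonneg h)
    have fin : h ^ 2 * pe z ≤ h ^ 2 * (pe z0 + 2 + 2 * P) := by linarith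
    exact le_of_mul_le_mul_left fin (by positivity)

lemma gma_gradx (p : ℝ × ℝ → ℝ) (hp : ContDiff ℝ 2 p) (hper : Biperiodic p) (k κ K : ℝ)
    (hk : |k| ≤ κ) (hK : 0 ≤ K) (hlow : ∀ z, -K ≤ pdx (pdx p) z - k * pdx p z) (z : ℝ × ℝ) :
    |pdx p z| ≤ K * Real.exp κ := by
  have := gma_grad1d (fun s : ℝ => p ((0, z.2) + s • ((1, 0) : ℝ × ℝ))) _ _ k κ K
    (gma_line p (hp.differentiable (by norm_num)) (0, z.2) (1, 0))
    (gma_line _ ((gma_c1 p hp (1, 0)).differentiable (by norm_num)) (0, z.2) (1, 0))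
    (by intro s; simpa using (hper s z.2).1) hk hK (fun s => hlow _) z.1
  simpa [pdx] using this

lemma gma_grady (p : ℝ × ℝ → ℝ) (hp : ContDiff ℝ 2 p) (hper : Biperiodic p) (k κ K : ℝ)
    (hk : |k| ≤ κ) (hK : 0 ≤ K) (hlow : ∀ z, -K ≤ pdy (pdy p) z - k * pdy p z) (z : ℝ × ℝ) :
    |pdy p z| ≤ K * Real.exp κ := by
  have := gma_grad1d (fun s : ℝ => p ((z.1, 0) + s • ((0, 1) : ℝ × ℝ))) _ _ k κ K
    (gma_line p (hp.differentiable (by norm_num)) (z.1, 0) (0, 1))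
    (gma_line _ ((gma_c1 p hp (0, 1)).differentiable (by norm_num)) (z.1, 0) (0, 1))
    (by intro s; simpa using (hper z.1 s).2) hk hK (fun s => hlow _) z.2
  simpa [pdy] using this

lemma gma_tl {t l x P : ℝ} (ht : t ∈ Set.Icc (0:ℝ) 1) (hx : |x| ≤ P) : |t * l * x| ≤ |l| * P := by
  rw [abs_mul, abs_mul, abs_of_nonneg ht.1]
  have : t * |l| ≤ |l| := by nlinarith [abs_nonneg l, ht.2]
  exact mul_le_mul this hx (abs_nonneg _) (abs_nonneg _)

lemma gma_grad (a b l11 l22 m11 m22 : ℝ) (ha : 0 < a) (hb : 0 < b) (h1 : m11 * l22 = 0) :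
    ∃ P : ℝ, 0 ≤ P ∧ ∀ t : ℝ, t ∈ Set.Icc (0:ℝ) 1 →
      ∀ p : ℝ × ℝ → ℝ, ContDiff ℝ 2 p → Biperiodic p →
      (∀ z, 0 < a + pdx (pdx p) z - t * l11 * pdx p z - t * m11 * pdy p z) →
      (∀ z, 0 < b + pdy (pdy p) z - t * l22 * pdx p z - t * m22 * pdy p z) →
      ∀ z, |pdx p z| ≤ P ∧ |pdy p z| ≤ P := by
  have htk : ∀ t l : ℝ, t ∈ Set.Icc (0:ℝ) 1 → |t * l| ≤ |l| := by
    intro t l ht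
    simpa using gma_tl (l := l) (x := 1) (P := 1) ht (by simp)
  rcases mul_eq_zero.1 h1 with h | h
  · set P1 := a * Real.exp |l11| with hP1
    set P2 := (b + |l22| * P1) * Real.exp |m22| with hP2
    refine ⟨max P1 P2, le_max_of_le_left (by positivity), ?_⟩
    intro t ht p hp hper hx hy
    have gx : ∀ z, |pdx p z| ≤ P1 := gma_gradx p hp hper (t * l11) _ _ (htk t _ ht) ha.le
      (fun z => by have := hx z; rw [h] at this; linarith)
    have gy : ∀ z, |pdy p z| ≤ P2 := gma_grady p hp hper (t * m22) _ _ (htk t _ ht) (by positivity)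
      (fun z => by
        have := hy z
        have h3 := (abs_le.1 (gma_tl (l := l22) ht (gx z))).1
        linarith)
    exact fun z => ⟨(gx z).trans (le_max_left _ _), (gy z).trans (le_max_right _ _)⟩
  · set P1 := b * Real.exp |m22| with hP1
    set P2 := (a + |m11| * P1) * Real.exp |l11| with hP2
    refine ⟨max P1 P2, le_max_of_le_left (by positivity), ?_⟩
    intro t ht p hp hper hx hy
    have gy : ∀ z, |pdy p z| ≤ P1 := gma_grady p hp hper (t * m22) _ _ (htk t _ ht) hb.le
      (fun z => by have := hy z; rw [h] at this; linarith)
    have gx : ∀ z, |pdx p z| ≤ P2 := gma_gradx p hp hper (t * l11) _ _ (htk t _ ht) (by positivity)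
      (fun z => by
        have := hx z
        have h3 := (abs_le.1 (gma_tl (l := m11) ht (gy z))).1
        linarith)
    exact fun z => ⟨(gx z).trans (le_max_right _ _), (gy z).trans (le_max_left _ _)⟩

lemma gma_Mbound {a b c x y z B : ℝ} (ha : 0 < a) (hd : 0 < a * b - c ^ 2)
    (hx : 0 < x) (hdet : 0 < x * z - y ^ 2) (h : b * x + a * z - 2 * c * y ≤ B) :
    x ≤ a * B / (a * b - c ^ 2) := by
  rw [le_div_iff₀ hd]
  have h1 := mul_le_mul_of_nonneg_left h (mul_pos ha hx).le
  have h2 : x * (x * (a * b - c ^ 2)) ≤ x * (a * B) := by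
    nlinarith [sq_nonneg (c * x - a * y), mul_pos (mul_pos ha ha) hdet]
  exact le_of_mul_le_mul_left h2 hx

lemma gma_off {x y z : ℝ} (hx : 0 < x) (hz : 0 < z) (h : 0 < x * z - y ^ 2) : |y| ≤ x + z := by
  apply abs_le_of_sq_le_sq _ (by linarith)
  nlinarith [mul_pos hx hz]

lemma gma_bd (f : ℝ × ℝ → ℝ) (hf : Continuous f) : ∃ C, 0 ≤ C ∧ ∀ z, ‖z‖ ≤ 2 → |f z| ≤ C := by
  obtain ⟨C, hC⟩ := (isCompact_closedBall (0 : ℝ × ℝ) 2).exists_bound_of_continuousOn hf.continuousOn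
  exact ⟨C, (norm_nonneg _).trans (hC 0 (by simp)), fun z hz => hC z (by simpa using hz)⟩

/-- A priori second-derivative estimates, uniform in `t ∈ [0,1]`, for solutions of the
deformed generalized Monge–Ampère equations on the 2-torus. -/
theorem gma_second_derivative_estimate (a b c l11 l12 l22 m11 m12 m22 : ℝ)
    (hpd : (!![a, c; c, b]).PosDef)
    (h1 : m11 * l22 = 0)
    (h2 : l11 * l22 - l12 ^ 2 = 0)
    (h3 : m11 * m22 - m12 ^ 2 = 0)
    (h4 : l11 * m22 + l22 * m11 - 2 * l12 * m12 = 0)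
    (F : ℝ × ℝ → ℝ) (hF : ContDiff ℝ (⊤ : ℕ∞) F) (hFper : Biperiodic F) :
    ∃ C : ℝ, 0 < C ∧ ∀ t : ℝ, t ∈ Set.Icc (0:ℝ) 1 →
      ∀ p : ℝ × ℝ → ℝ, ContDiff ℝ 2 p → Biperiodic p →
      (∀ z : ℝ × ℝ,
        (a + pdx (pdx p) z - t * l11 * pdx p z - t * m11 * pdy p z) *
            (b + pdy (pdy p) z - t * l22 * pdx p z - t * m22 * pdy p z) -
          (c + pdy (pdx p) z - t * l12 * pdx p z - t * m12 * pdy p z) ^ 2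
            = t * Real.exp (F z) + (1 - t) * (a * b - c ^ 2)) →
      (∀ z : ℝ × ℝ,
        (!![a + pdx (pdx p) z - t * l11 * pdx p z - t * m11 * pdy p z,
            c + pdy (pdx p) z - t * l12 * pdx p z - t * m12 * pdy p z;
            c + pdy (pdx p) z - t * l12 * pdx p z - t * m12 * pdy p z,
            b + pdy (pdy p) z - t * l22 * pdx p z - t * m22 * pdy p z]).PosDef) →
      ∀ z : ℝ × ℝ, |pdx (pdx p) z| ≤ C ∧ |pdy (pdx p) z| ≤ C ∧ |pdy (pdy p) z| ≤ C := by
  obtain ⟨ha, hb, hd⟩ := gma_posdef hpd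
  have hF2 : ContDiff ℝ 2 F := hF.of_le (by
    have : ((2 : ℕ∞) : WithTop ℕ∞) ≤ ((⊤ : ℕ∞) : WithTop ℕ∞) := WithTop.coe_le_coe.2 le_top
    exact this)
  obtain ⟨P, hP0, hP⟩ := gma_grad a b l11 l22 m11 m22 ha hb h1
  obtain ⟨C1, hC10, hC1⟩ := gma_bd _ (gma_c0 F hF2 (1, 0) (1, 0))
  obtain ⟨C2, hC20, hC2⟩ := gma_bd _ (gma_c0 F hF2 (0, 1) (0, 1))
  obtain ⟨E, hE0, hE⟩ := gma_bd (fun z => Real.exp (F z)) (Real.continuous_exp.comp hF.continuous)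
  have hE' : ∀ z, ‖z‖ ≤ 2 → Real.exp (F z) ≤ E := fun z hz => (le_abs_self _).trans (hE z hz)
  set B1 := 2 * (E + (a * b - c ^ 2)) + E * C1 with hB1
  set B2 := 2 * (E + (a * b - c ^ 2)) + E * C2 with hB2
  have hB10 : 0 ≤ B1 := by positivity
  have hB20 : 0 ≤ B2 := by positivity
  set K1 := |l11| * P + |m11| * P with hK1
  set K2 := |l22| * P + |m22| * P with hK2
  set K3 := |l12| * P + |m12| * P with hK3
  have hK10 : 0 ≤ K1 := by positivity
  have hK20 : 0 ≤ K2 := by positivity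
  have hK30 : 0 ≤ K3 := by positivity
  set U1 := a * B1 / (a * b - c ^ 2) + K1 + 2 + 2 * P + a with hU1
  set U2 := b * B2 / (a * b - c ^ 2) + K2 + 2 + 2 * P + b with hU2
  have hq1 : 0 ≤ a * B1 / (a * b - c ^ 2) := by positivity
  have hq2 : 0 ≤ b * B2 / (a * b - c ^ 2) := by positivity
  refine ⟨U1 + U2 + K1 + K2 + K3 + a + b + |c|, by positivity, ?_⟩
  intro t ht p hp hper heq hell z
  set M11 : ℝ × ℝ → ℝ := fun z => a + pdx (pdx p) z - t * l11 * pdx p z - t * m11 * pdy p z with hM11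
  set M22 : ℝ × ℝ → ℝ := fun z => b + pdy (pdy p) z - t * l22 * pdx p z - t * m22 * pdy p z with hM22
  set M12 : ℝ × ℝ → ℝ := fun z => c + pdy (pdx p) z - t * l12 * pdx p z - t * m12 * pdy p z with hM12
  have hpos : ∀ z, 0 < M11 z ∧ 0 < M22 z ∧ 0 < M11 z * M22 z - M12 z ^ 2 :=
    fun z => gma_posdef (hell z)
  have hg := hP t ht p hp hper (fun z => (hpos z).1) (fun z => (hpos z).2.1)
  have w1 : ∀ z, |M11 z - (a + pdx (pdx p) z)| ≤ K1 := by
    intro z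
    have e1 := abs_le.1 (gma_tl (l := l11) ht (hg z).1)
    have e2 := abs_le.1 (gma_tl (l := m11) ht (hg z).2)
    simp only [hM11, abs_le]
    constructor <;> linarith
  have w2 : ∀ z, |M22 z - (b + pdy (pdy p) z)| ≤ K2 := by
    intro z
    have e1 := abs_le.1 (gma_tl (l := l22) ht (hg z).1)
    have e2 := abs_le.1 (gma_tl (l := m22) ht (hg z).2)
    simp only [hM22, abs_le]
    constructor <;> linarith
  have w3 : ∀ z, |M12 z - (c + pdy (pdx p) z)| ≤ K3 := by
    intro z
    have e1 := abs_le.1 (gma_tl (l := l12) ht (hg z).1)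
    have e2 := abs_le.1 (gma_tl (l := m12) ht (hg z).2)
    simp only [hM12, abs_le]
    constructor <;> linarith
  obtain ⟨z1, hz1, hz1'⟩ := gma_core a b c l11 l12 l22 m11 m12 m22 hd.le F hF2 (1, 0) (by simp)
    C1 E P hC10 hC1 hE' t ht p hp hper hg M11 M12 M22 (fun _ => rfl) (fun _ => rfl) (fun _ => rfl)
    heq hpos z
  obtain ⟨z2, hz2, hz2'⟩ := gma_core a b c l11 l12 l22 m11 m12 m22 hd.le F hF2 (0, 1) (by simp)
    C2 E P hC20 hC2 hE' t ht p hp hper hg M11 M12 M22 (fun _ => rfl) (fun _ => rfl) (fun _ => rfl)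
    heq hpos z
  change pdx (pdx p) z ≤ pdx (pdx p) z1 + 2 + 2 * P at hz1'
  change pdy (pdy p) z ≤ pdy (pdy p) z2 + 2 + 2 * P at hz2'
  have n1 := gma_Mbound ha hd (hpos z1).1 (hpos z1).2.2 hz1
  have n2 := gma_Mbound (a := b) (b := a) (c := c) (x := M22 z2) (y := M12 z2) (z := M11 z2) (B := B2)
    hb (by linarith) (hpos z2).2.1 (by linarith [(hpos z2).2.2]) (by linarith)
  rw [mul_comm b a] at n2
  have u1 : pdx (pdx p) z ≤ U1 := by
    have := (abs_le.1 (w1 z1)).1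
    linarith
  have u2 : pdy (pdy p) z ≤ U2 := by
    have := (abs_le.1 (w2 z2)).1
    linarith
  obtain ⟨o1, o2, o3⟩ := hpos z
  have v1 := abs_le.1 (w1 z)
  have v2 := abs_le.1 (w2 z)
  have v3 := abs_le.1 (w3 z)
  have o4 : |M12 z| ≤ M11 z + M22 z := gma_off o1 o2 o3
  have o5 := abs_le.1 o4
  have c1 := neg_abs_le c
  have c2 := le_abs_self c
  refine ⟨abs_le.2 ⟨?_, ?_⟩, abs_le.2 ⟨?_, ?_⟩, abs_le.2 ⟨?_, ?_⟩⟩ <;> linarith [abs_nonneg c]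
end
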